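/- arXiv:2202.10127 — 8 statements merged into one kernel-verified Lean document; each statement's English description precedes it below -/
import Mathlib

section
/- Let n1 ≥ n2 ≥ n3 ≥ n4 ≥ 2 and a ≥ 1 be integers. Then F_{n1} + F_{n2} + F_{n3} + F_{n4} = 2^a holds if and only if the tuple (n1, n2, n3, n4, a) belongs to the following explicit list: (2,2,2,2,2), (3,3,3,3,3), (5,2,2,2,3), (7,2,2,2,4), (4,4,2,2,3), (13,8,2,2,8), (4,3,3,2,3), (6,5,3,2,4), (8,6,3,2,5), (16,9,3,2,10), (10,5,4,2,6), (5,5,5,2,4), (8,5,5,2,5), (7,7,5,2,5), (9,8,6,2,6), (8,8,8,2,6), (10,5,3,3,6), (6,4,4,3,4), (11,9,4,3,7), (13,7,6,3,8), (12,11,8,3,8), (12,10,10,3,8), (10,4,4,4,6), (5,5,4,4,4), (8,5,4,4,5), (7,7,4,4,5), (7,6,6,4,5), (16,8,7,4,10), (15,14,9,4,10), (13,7,5,5,8), (11,8,7,5,7), (10,10,7,5,7), (10,9,9,5,7), (16,8,6,6,10), (11,7,7,7,7), (6,6,6,6,5). -/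
namespace PowFib

/-- Product of all the moduli used. -/
def B : ℕ := 2048*63*23*1103*769*2207*3167*4481*1087*127*383*1359361*31*41*61*15361*1689601

abbrev E := ℕ × ℕ
abbrev St := E → E → E → E → ℕ → Bool

noncomputable def force (n : ℕ) (k : ℕ → Bool) : Bool :=
  Nat.rec (k 0) (fun m _ => k (Nat.succ m)) n

theorem force_eq (n : ℕ) (k : ℕ → Bool) : force n k = k n := by
  cases n <;> rfl

noncomputable def allL (l : List E) (p : E → Bool) : Bool :=
  List.rec true (fun h _ ih => cond (p h) ih false) l

theorem allL_mem {l : List E} {p : E → Bool} (h : allL l p = true) : ∀ x ∈ l, p x = true := by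
  induction l with
  | nil => simp
  | cons y t ih =>
    have h' : cond (p y) (allL t p) false = true := h
    cases hy : p y with
    | false => simp [hy] at h'
    | true =>
      simp only [hy, cond_true] at h'
      intro x hx
      rcases List.mem_cons.1 hx with rfl | hx
      · exact hy
      · exact ih h' x hx

noncomputable def allSuf (l : List E) (p : E → List E → Bool) : Bool :=
  List.rec true (fun h t ih => cond (p h (h :: t)) ih false) l

theorem allSuf_get {l : List E} {p : E → List E → Bool} (h : allSuf l p = true) :
    ∀ i (hi : i < l.length), p l[i] (l.drop i) = true := by
  induction l with
  | nil => intro i hi; simp at hi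
  | cons y t ih =>
    have h' : cond (p y (y :: t)) (allSuf t p) false = true := h
    cases hy : p y (y :: t) with
    | false => simp [hy] at h'
    | true =>
      simp only [hy, cond_true] at h'
      intro i hi
      cases i with
      | zero => simpa using hy
      | succ i => simpa using ih h' i (by simpa using hi)

/-- all lifts of a pair, built in continuation style -/
noncomputable def mk (c d : ℕ) (q : ℕ) : ℕ → ℕ → (List E → Bool) → Bool :=
  Nat.rec (fun _ _ k => k [])
    (fun _ ih p f k =>
      force (Nat.mod (Nat.add (Nat.mul p c) (Nat.mul f d)) B) fun p' =>
      force (Nat.mod (Nat.add (Nat.mul f (Nat.add c d)) (Nat.mul p d)) B) fun f' =>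
      ih p' f' (fun l => k ((p, f) :: l))) q

def sh (c d : ℕ) (x : E) : E :=
  ((x.1 * c + x.2 * d) % B, (x.2 * (c + d) + x.1 * d) % B)

def lifts (c d : ℕ) : ℕ → E → List E
  | 0, _ => []
  | q+1, x => x :: lifts c d q (sh c d x)

theorem mk_eq (c d q p f : ℕ) (k : List E → Bool) : mk c d q p f k = k (lifts c d q (p, f)) := by
  induction q generalizing p f k with
  | zero => rfl
  | succ q ih =>
    have : mk c d (q+1) p f k =
      force (Nat.mod (Nat.add (Nat.mul p c) (Nat.mul f d)) B) fun p' =>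
      force (Nat.mod (Nat.add (Nat.mul f (Nat.add c d)) (Nat.mul p d)) B) fun f' =>
      mk c d q p' f' (fun l => k ((p, f) :: l)) := rfl
    rw [this, force_eq, force_eq, ih]
    rfl

noncomputable def liftN (c d q : ℕ) (K : St) : St := fun x1 x2 x3 x4 a =>
  mk c d q x1.1 x1.2 fun l1 => mk c d q x2.1 x2.2 fun l2 =>
  mk c d q x3.1 x3.2 fun l3 => mk c d q x4.1 x4.2 fun l4 =>
  allL l1 fun y1 => allL l2 fun y2 => allL l3 fun y3 => allL l4 fun y4 => K y1 y2 y3 y4 a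

noncomputable def liftA (m q : ℕ) (K : St) : St := fun x1 x2 x3 x4 =>
  Nat.rec (fun _ => true)
    (fun _ ih a => cond (K x1 x2 x3 x4 a) (force (Nat.add a m) fun a' => ih a') false) q

noncomputable def tst (N e : ℕ) (K : St) : St := fun x1 x2 x3 x4 a =>
  cond (Nat.beq
      (Nat.mod (Nat.pow (Nat.mod (Nat.add (Nat.add (Nat.add x1.2 x2.2) x3.2) x4.2) N) e) N)
      (Nat.mod (Nat.pow (Nat.mod (Nat.pow 2 a) N) e) N))
    (K x1 x2 x3 x4 a) true

def Rel (P n : ℕ) (x : E) : Prop :=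
  ∃ r, r + 1 ≡ n [MOD P] ∧ x.1 ≡ Nat.fib r [MOD B] ∧ x.2 ≡ Nat.fib (r+1) [MOD B]

/-- exact pair for the period `P` -/
def LP (P c d : ℕ) : Prop :=
  ∃ r, r + 1 = P ∧ c ≡ Nat.fib r [MOD B] ∧ d ≡ Nat.fib (r+1) [MOD B]

theorem sh_cong {c d r s : ℕ} {x : E} (hc : c ≡ Nat.fib r [MOD B]) (hd : d ≡ Nat.fib (r+1) [MOD B])
    (h1 : x.1 ≡ Nat.fib s [MOD B]) (h2 : x.2 ≡ Nat.fib (s+1) [MOD B]) :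
    (sh c d x).1 ≡ Nat.fib (s + r + 1) [MOD B] ∧ (sh c d x).2 ≡ Nat.fib (s + r + 1 + 1) [MOD B] := by
  constructor
  · refine (Nat.mod_modEq _ _).trans ?_
    rw [Nat.fib_add]
    exact (h1.mul hc).add (h2.mul hd)
  · refine (Nat.mod_modEq _ _).trans ?_
    have : Nat.fib (s + r + 1 + 1) = Nat.fib (s+1) * (Nat.fib r + Nat.fib (r+1)) +
        Nat.fib s * Nat.fib (r+1) := by
      have h := Nat.fib_add s (r+1)
      rw [show s + (r+1) + 1 = s + r + 1 + 1 by ring] at h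
      rw [h, Nat.fib_add_two]; ring
    rw [this]
    exact (h2.mul (hc.add hd)).add (h1.mul hd)

theorem LP_double {P c d c' d' : ℕ} (h : LP P c d) (h1 : (sh c d (c, d)) = (c', d')) :
    LP (2 * P) c' d' := by
  obtain ⟨r, hr, hc, hd⟩ := h
  have := sh_cong (x := (c, d)) hc hd hc hd
  rw [h1] at this
  exact ⟨r + r + 1, by omega, this.1, this.2⟩

theorem LP_five {P c d c' d' : ℕ} (h : LP P c d)
    (h1 : sh c d (sh c d (sh c d (sh c d (c, d)))) = (c', d')) :
    LP (5 * P) c' d' := by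
  obtain ⟨r, hr, hc, hd⟩ := h
  have h2 := sh_cong (x := (c, d)) hc hd hc hd
  have h3 := sh_cong hc hd h2.1 h2.2
  have h4 := sh_cong hc hd h3.1 h3.2
  have h5 := sh_cong hc hd h4.1 h4.2
  rw [h1] at h5
  exact ⟨_, by omega, h5.1, h5.2⟩

theorem Rel_lift {P c d : ℕ} (hL : LP P c d) (q : ℕ) (n : ℕ) :
    ∀ x : E, Rel P n x → 0 < q → ∃ y ∈ lifts c d q x, Rel (q * P) n y := by
  obtain ⟨s, hs, hc, hd⟩ := hL
  have key : ∀ k : ℕ, ∀ (r : ℕ) (x : E), x.1 ≡ Nat.fib r [MOD B] → x.2 ≡ Nat.fib (r+1) [MOD B] →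
      ∀ j < k, ∃ y ∈ lifts c d k x, y.1 ≡ Nat.fib (r + j * P) [MOD B] ∧
        y.2 ≡ Nat.fib (r + j * P + 1) [MOD B] := by
    intro k
    induction k with
    | zero => intro r x _ _ j hj; omega
    | succ k ih =>
      intro r x h1 h2 j hj
      cases j with
      | zero => exact ⟨x, by simp [lifts], by simpa using h1, by simpa using h2⟩
      | succ j =>
        have h3 := sh_cong hc hd h1 h2
        obtain ⟨y, hy, hy1, hy2⟩ := ih _ _ h3.1 h3.2 j (by omega)
        have e : r + s + 1 + j * P = r + (j + 1) * P := by rw [← hs]; ring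
        rw [e] at hy1 hy2
        exact ⟨y, by simp [lifts, hy], hy1, hy2⟩
  rintro x ⟨r, hr, h1, h2⟩ hq
  have hP : 0 < P := by omega
  -- choose the shift
  have hz : ∃ t : ℤ, (n : ℤ) - (r + 1 : ℕ) = P * t := by
    obtain ⟨t, ht⟩ := (Nat.modEq_iff_dvd.1 hr)
    exact ⟨t, ht⟩
  obtain ⟨t, ht⟩ := hz
  have hq' : (0 : ℤ) < q := by exact_mod_cast hq
  obtain ⟨j, hj⟩ := Int.eq_ofNat_of_zero_le (Int.emod_nonneg t hq'.ne')
  have hjq : j < q := by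
    have := Int.emod_lt_of_pos t hq'
    omega
  obtain ⟨y, hy, hy1, hy2⟩ := key q r x h1 h2 j hjq
  refine ⟨y, hy, r + j * P, ?_, hy1, hy2⟩
  rw [Nat.modEq_iff_dvd]
  refine ⟨t / q, ?_⟩
  have := Int.emod_add_mul_ediv t q
  rw [hj] at this
  push_cast at ht ⊢
  have : (n : ℤ) = r + 1 + P * (j + q * (t / q)) := by
    rw [show ((j : ℤ) + q * (t / q)) = t from this]; linarith
  rw [this]; ring

def Sound (P m : ℕ) (K : St) : Prop :=
  ∀ n1 n2 n3 n4 a x1 x2 x3 x4 a0, 11 ≤ a → 11 ≤ a0 → a0 ≡ a [MOD m] →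
    Rel P n1 x1 → Rel P n2 x2 → Rel P n3 x3 → Rel P n4 x4 →
    Nat.fib n1 + Nat.fib n2 + Nat.fib n3 + Nat.fib n4 = 2 ^ a →
    K x1 x2 x3 x4 a0 = true → False

theorem liftN_sound {P c d m q : ℕ} {K : St} (hL : LP P c d) (hq : 0 < q)
    (hK : Sound (q * P) m K) : Sound P m (liftN c d q K) := by
  intro n1 n2 n3 n4 a x1 x2 x3 x4 a0 ha ha0 haa r1 r2 r3 r4 he h
  unfold liftN at h
  simp only [mk_eq] at h
  obtain ⟨y1, m1, s1⟩ := Rel_lift hL q n1 x1 r1 hq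
  obtain ⟨y2, m2, s2⟩ := Rel_lift hL q n2 x2 r2 hq
  obtain ⟨y3, m3, s3⟩ := Rel_lift hL q n3 x3 r3 hq
  obtain ⟨y4, m4, s4⟩ := Rel_lift hL q n4 x4 r4 hq
  have h := allL_mem (allL_mem (allL_mem (allL_mem h y1 m1) y2 m2) y3 m3) y4 m4
  exact hK n1 n2 n3 n4 a y1 y2 y3 y4 a0 ha ha0 haa s1 s2 s3 s4 he h

theorem liftA_all {m q : ℕ} {K : St} {x1 x2 x3 x4 : E} : ∀ {a : ℕ},
    liftA m q K x1 x2 x3 x4 a = true → ∀ j < q, K x1 x2 x3 x4 (a + j * m) = true := by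
  induction q with
  | zero => intro a _ j hj; omega
  | succ q ih =>
    intro a h j hj
    have h' : cond (K x1 x2 x3 x4 a)
      (force (Nat.add a m) fun a' => liftA m q K x1 x2 x3 x4 a') false = true := h
    cases hy : K x1 x2 x3 x4 a with
    | false => simp [hy] at h'
    | true =>
      simp only [hy, cond_true, force_eq] at h'
      cases j with
      | zero => simpa using hy
      | succ j =>
        have := ih h' j (by omega)
        rw [show a + (j+1) * m = Nat.add a m + j * m by
          show a + (j+1) * m = a + m + j * m
          ring]
        exact this

theorem liftA_sound {P m q : ℕ} {K : St} (hq : 0 < q)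
    (hK : Sound P (q * m) K) : Sound P m (liftA m q K) := by
  intro n1 n2 n3 n4 a x1 x2 x3 x4 a0 ha ha0 haa r1 r2 r3 r4 he h
  obtain ⟨t, ht⟩ := Nat.modEq_iff_dvd.1 haa
  have hq' : (0 : ℤ) < q := by exact_mod_cast hq
  obtain ⟨j, hj⟩ := Int.eq_ofNat_of_zero_le (Int.emod_nonneg t hq'.ne')
  have hjq : j < q := by
    have := Int.emod_lt_of_pos t hq'
    omega
  refine hK n1 n2 n3 n4 a x1 x2 x3 x4 (a0 + j * m) ha (by omega) ?_ r1 r2 r3 r4 he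
    (liftA_all h j hjq)
  rw [Nat.modEq_iff_dvd]
  refine ⟨t / q, ?_⟩
  have := Int.emod_add_mul_ediv t q
  rw [hj] at this
  push_cast at ht ⊢
  have : (a : ℤ) = a0 + m * (j + q * (t / q)) := by
    rw [show ((j : ℤ) + q * (t / q)) = t from this]; linarith
  rw [this]; ring

theorem pow_per {N M : ℕ} (h : 2 ^ (11 + M) % N = 2 ^ 11 % N) :
    ∀ k u, 11 ≤ u → 2 ^ (u + k * M) ≡ 2 ^ u [MOD N] := by
  intro k
  induction k with
  | zero => intro u _; simp [Nat.ModEq]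
  | succ k ih =>
    intro u hu
    have h1 : 2 ^ (u + M) ≡ 2 ^ u [MOD N] := by
      obtain ⟨v, rfl⟩ := Nat.exists_eq_add_of_le hu
      have := Nat.ModEq.mul_right (2 ^ v) (show 2 ^ (11 + M) ≡ 2 ^ 11 [MOD N] from h)
      rw [← pow_add, ← pow_add] at this
      rwa [show 11 + v + M = 11 + M + v by ring]
    have h2 := ih (u + M) (by omega)
    rw [show u + (k+1) * M = u + M + k * M by ring]
    exact h2.trans h1

theorem pow_cong {N M u v : ℕ} (h : 2 ^ (11 + M) % N = 2 ^ 11 % N) (hu : 11 ≤ u) (hv : 11 ≤ v)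
    (huv : u ≡ v [MOD M]) : 2 ^ u ≡ 2 ^ v [MOD N] := by
  wlog hle : u ≤ v generalizing u v
  · exact (this hv hu huv.symm (by omega)).symm
  obtain ⟨k, hk⟩ := (Nat.modEq_iff_dvd' hle).1 huv
  have : v = u + k * M := by rw [mul_comm k M, ← hk]; omega
  rw [this]
  exact (pow_per h k u hu).symm

theorem fib_per {N P c d : ℕ} (hL : LP P c d) (hN : N ∣ B) (h1 : c % N = 1 % N) (h2 : d % N = 0) :
    ∀ n r, n ≡ r [MOD P] → Nat.fib n ≡ Nat.fib r [MOD N] := by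
  obtain ⟨s, hs, hc, hd⟩ := hL
  have hc' : Nat.fib s ≡ 1 [MOD N] := ((hc.of_dvd hN).symm).trans h1
  have hd' : Nat.fib (s+1) ≡ 0 [MOD N] := ((hd.of_dvd hN).symm).trans (by simpa [Nat.ModEq] using h2)
  have step : ∀ r, Nat.fib (r + P) ≡ Nat.fib r [MOD N] := by
    intro r
    rw [← hs, ← add_assoc, Nat.fib_add]
    simpa using (Nat.ModEq.mul_left (Nat.fib r) hc').add (Nat.ModEq.mul_left (Nat.fib (r+1)) hd')
  have steps : ∀ k r, Nat.fib (r + k * P) ≡ Nat.fib r [MOD N] := by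
    intro k
    induction k with
    | zero => intro r; simp [Nat.ModEq]
    | succ k ih =>
      intro r
      rw [show r + (k+1) * P = r + k * P + P by ring]
      exact (step _).trans (ih r)
  intro n r h
  rcases le_total n r with hle | hle
  · obtain ⟨k, hk⟩ := (Nat.modEq_iff_dvd' hle).1 h
    have : r = n + k * P := by rw [mul_comm k P, ← hk]; omega
    rw [this]; exact (steps k n).symm
  · obtain ⟨k, hk⟩ := (Nat.modEq_iff_dvd' hle).1 h.symm
    have : n = r + k * P := by rw [mul_comm k P, ← hk]; omega
    rw [this]; exact steps k r

theorem tst_sound {P c d m N e : ℕ} {K : St} (hL : LP P c d)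
    (hs : (Nat.beq (B % N) 0 && Nat.beq (c % N) (1 % N) && Nat.beq (d % N) 0 && Nat.ble 1 e &&
      Nat.beq (2 ^ (11 + m * e) % N) (2 ^ 11 % N)) = true)
    (hK : Sound P m K) : Sound P m (tst N e K) := by
  simp only [Bool.and_eq_true, Nat.beq_eq, Nat.ble_eq] at hs
  obtain ⟨⟨⟨⟨hN, h1⟩, h2⟩, he1⟩, hp⟩ := hs
  intro n1 n2 n3 n4 a x1 x2 x3 x4 a0 ha ha0 haa r1 r2 r3 r4 he h
  have hN := Nat.dvd_of_mod_eq_zero hN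
  have per := fib_per hL hN h1 h2
  have red : ∀ n x, Rel P n x → x.2 ≡ Nat.fib n [MOD N] := by
    rintro n x ⟨r, hr, _, hf⟩
    exact (hf.of_dvd hN).trans (per _ _ hr)
  have hsum : x1.2 + x2.2 + x3.2 + x4.2 ≡ 2 ^ a [MOD N] := by
    rw [← he]
    exact (((red _ _ r1).add (red _ _ r2)).add (red _ _ r3)).add (red _ _ r4)
  have hpow : (2 ^ a) ^ e ≡ (2 ^ a0) ^ e [MOD N] := by
    rw [← pow_mul, ← pow_mul]
    refine pow_cong hp (ha.trans (Nat.le_mul_of_pos_right _ he1)) (ha0.trans (Nat.le_mul_of_pos_right _ he1)) ?_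
    exact (Nat.ModEq.mul_right' e haa).symm
  have hfin : ((x1.2 + x2.2 + x3.2 + x4.2) % N) ^ e ≡ ((2 ^ a0) % N) ^ e [MOD N] :=
    (((Nat.mod_modEq _ _).trans hsum).pow e).trans
      (hpow.trans (((Nat.mod_modEq _ _).symm).pow e))
  have h' : cond (Nat.beq (((x1.2 + x2.2 + x3.2 + x4.2) % N) ^ e % N) (((2 ^ a0) % N) ^ e % N))
    (K x1 x2 x3 x4 a0) true = true := h
  rw [show Nat.beq (((x1.2 + x2.2 + x3.2 + x4.2) % N) ^ e % N) (((2 ^ a0) % N) ^ e % N) = true from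
    Nat.beq_eq ▸ hfin, cond_true] at h'
  exact hK n1 n2 n3 n4 a x1 x2 x3 x4 a0 ha ha0 haa r1 r2 r3 r4 he h'

theorem fail_sound (P m : ℕ) : Sound P m (fun _ _ _ _ _ => false) := by
  intro n1 n2 n3 n4 a x1 x2 x3 x4 a0 _ _ _ _ _ _ _ _ h
  exact Bool.noConfusion h

theorem LP12 : LP 12 89 144 :=
  ⟨11, rfl, by decide, by decide⟩

theorem LP24 : LP 24 28657 46368 :=
  LP_double LP12 (by decide +kernel)

theorem LP48 : LP 48 2971215073 4807526976 :=
  LP_double LP24 (by decide +kernel)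

theorem LP96 : LP 96 31940434634990099905 51680708854858323072 :=
  LP_double LP48 (by decide +kernel)

theorem LP192 : LP 192 3691087032412706639440686994833808526209 5972304273877744135569338397692020533504 :=
  LP_double LP96 (by decide +kernel)

theorem LP384 : LP 384 5093665172901954047505489098916729230728020759985921 3248882399049252838542755286207549272482931684964864 :=
  LP_double LP192 (by decide +kernel)

theorem LP768 : LP 768 885702650513755524768438698721399232101505644805633 6776174181608898654888987628276096050021609751741440 :=
  LP_double LP384 (by decide +kernel)

theorem LP1536 : LP 1536 2325192205072783217916637596856608855700088236968961 6448341783213000655025553727906220773172855642013696 :=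
  LP_double LP768 (by decide +kernel)

theorem LP7680 : LP 7680 20301927189700744370123921158453361649746934991873 0 :=
  LP_five LP1536 (by decide +kernel)

theorem LP15360 : LP 15360 1 0 :=
  LP_double LP7680 (by decide +kernel)

def K37 : St := fun _ _ _ _ _ => false

theorem S37 : Sound 15360 6 K37 := fail_sound 15360 6

noncomputable def K36 : St := tst 1689601 6400 K37

theorem S36 : Sound 15360 6 K36 := tst_sound LP15360 (by decide +kernel) S37

noncomputable def K35 : St := tst 2048 1 K36

theorem S35 : Sound 15360 6 K35 := tst_sound LP15360 (by decide +kernel) S36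

noncomputable def K34 : St := liftN 20301927189700744370123921158453361649746934991873 0 2 K35

theorem S34 : Sound 7680 6 K34 := liftN_sound LP7680 (by norm_num) S35

noncomputable def K33 : St := tst 15361 640 K34

theorem S33 : Sound 7680 6 K33 := tst_sound LP7680 (by decide +kernel) S34

noncomputable def K32 : St := tst 61 10 K33

theorem S32 : Sound 7680 6 K32 := tst_sound LP7680 (by decide +kernel) S33

noncomputable def K31 : St := tst 41 10 K32

theorem S31 : Sound 7680 6 K31 := tst_sound LP7680 (by decide +kernel) S32

noncomputable def K30 : St := tst 31 5 K31

theorem S30 : Sound 7680 6 K30 := tst_sound LP7680 (by decide +kernel) S31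

noncomputable def K29 : St := liftN 2325192205072783217916637596856608855700088236968961 6448341783213000655025553727906220773172855642013696 5 K30

theorem S29 : Sound 1536 6 K29 := liftN_sound LP1536 (by norm_num) S30

noncomputable def K28 : St := tst 1359361 18880 K29

theorem S28 : Sound 1536 6 K28 := tst_sound LP1536 (by decide +kernel) S29

noncomputable def K27 : St := tst 1024 1 K28

theorem S27 : Sound 1536 6 K27 := tst_sound LP1536 (by decide +kernel) S28

noncomputable def K26 : St := liftN 885702650513755524768438698721399232101505644805633 6776174181608898654888987628276096050021609751741440 2 K27

theorem S26 : Sound 768 6 K26 := liftN_sound LP768 (by norm_num) S27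

noncomputable def K25 : St := tst 383 191 K26

theorem S25 : Sound 768 6 K25 := tst_sound LP768 (by decide +kernel) S26

noncomputable def K24 : St := tst 127 7 K25

theorem S24 : Sound 768 6 K24 := tst_sound LP768 (by decide +kernel) S25

noncomputable def K23 : St := tst 512 1 K24

theorem S23 : Sound 768 6 K23 := tst_sound LP768 (by decide +kernel) S24

noncomputable def K22 : St := liftN 5093665172901954047505489098916729230728020759985921 3248882399049252838542755286207549272482931684964864 2 K23

theorem S22 : Sound 384 6 K22 := liftN_sound LP384 (by norm_num) S23

noncomputable def K21 : St := tst 1087 181 K22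

theorem S21 : Sound 384 6 K21 := tst_sound LP384 (by decide +kernel) S22

noncomputable def K20 : St := tst 4481 280 K21

theorem S20 : Sound 384 6 K20 := tst_sound LP384 (by decide +kernel) S21

noncomputable def K19 : St := tst 256 1 K20

theorem S19 : Sound 384 6 K19 := tst_sound LP384 (by decide +kernel) S20

noncomputable def K18 : St := liftN 3691087032412706639440686994833808526209 5972304273877744135569338397692020533504 2 K19

theorem S18 : Sound 192 6 K18 := liftN_sound LP192 (by norm_num) S19

noncomputable def K17 : St := tst 3167 1583 K18

theorem S17 : Sound 192 6 K17 := tst_sound LP192 (by decide +kernel) S18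

noncomputable def K16 : St := tst 2207 1103 K17

theorem S16 : Sound 192 6 K16 := tst_sound LP192 (by decide +kernel) S17

noncomputable def K15 : St := tst 769 64 K16

theorem S15 : Sound 192 6 K15 := tst_sound LP192 (by decide +kernel) S16

noncomputable def K14 : St := tst 128 1 K15

theorem S14 : Sound 192 6 K14 := tst_sound LP192 (by decide +kernel) S15

noncomputable def K13 : St := liftN 31940434634990099905 51680708854858323072 2 K14

theorem S13 : Sound 96 6 K13 := liftN_sound LP96 (by norm_num) S14

noncomputable def K12 : St := tst 1103 29 K13

theorem S12 : Sound 96 6 K12 := tst_sound LP96 (by decide +kernel) S13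

noncomputable def K11 : St := tst 64 1 K12

theorem S11 : Sound 96 6 K11 := tst_sound LP96 (by decide +kernel) S12

noncomputable def K10 : St := liftN 2971215073 4807526976 2 K11

theorem S10 : Sound 48 6 K10 := liftN_sound LP48 (by norm_num) S11

noncomputable def K9 : St := tst 63 1 K10

theorem S9 : Sound 48 6 K9 := tst_sound LP48 (by decide +kernel) S10

noncomputable def K8 : St := liftA 1 6 K9

theorem S8 : Sound 48 1 K8 := liftA_sound (by norm_num) S9

noncomputable def K7 : St := tst 23 11 K8

theorem S7 : Sound 48 1 K7 := tst_sound LP48 (by decide +kernel) S8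

noncomputable def K6 : St := tst 7 3 K7

theorem S6 : Sound 48 1 K6 := tst_sound LP48 (by decide +kernel) S7

noncomputable def K5 : St := tst 32 1 K6

theorem S5 : Sound 48 1 K5 := tst_sound LP48 (by decide +kernel) S6

noncomputable def K4 : St := liftN 28657 46368 2 K5

theorem S4 : Sound 24 1 K4 := liftN_sound LP24 (by norm_num) S5

noncomputable def K3 : St := tst 9 6 K4

theorem S3 : Sound 24 1 K3 := tst_sound LP24 (by decide +kernel) S4

noncomputable def K2 : St := tst 16 1 K3

theorem S2 : Sound 24 1 K2 := tst_sound LP24 (by decide +kernel) S3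

noncomputable def K1 : St := liftN 89 144 2 K2

theorem S1 : Sound 12 1 K1 := liftN_sound LP12 (by norm_num) S2

noncomputable def K0 : St := tst 8 1 K1

theorem S0 : Sound 12 1 K0 := tst_sound LP12 (by decide +kernel) S1

def base : List E := [(0, 1), (1, 1), (1, 2), (2, 3), (3, 5), (5, 8), (8, 13), (13, 21), (21, 34), (34, 55), (55, 89), (89, 144)]

noncomputable def chk : Bool :=
  allSuf base fun x l => allSuf l fun y l => allSuf l fun z l => allL l fun w => K0 x y z w 11

set_option maxRecDepth 100000 in
theorem chk_true : chk = true := by decide +kernel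

theorem base_rel (n i : ℕ) (hi : i < base.length) (h : (n + 11) % 12 = i) : Rel 12 n base[i] := by
  have hi' : i < 12 := hi
  refine ⟨i, ?_, ?_⟩
  · unfold Nat.ModEq; omega
  · clear h
    interval_cases i <;> exact ⟨rfl, rfl⟩

theorem sorted_case (n1 n2 n3 n4 a : ℕ) (ha : 11 ≤ a)
    (h12 : (n1 + 11) % 12 ≤ (n2 + 11) % 12) (h23 : (n2 + 11) % 12 ≤ (n3 + 11) % 12)
    (h34 : (n3 + 11) % 12 ≤ (n4 + 11) % 12)
    (he : Nat.fib n1 + Nat.fib n2 + Nat.fib n3 + Nat.fib n4 = 2 ^ a) : False := by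
  have hc := chk_true
  unfold chk at hc
  have hlen : base.length = 12 := rfl
  obtain ⟨i1, e1⟩ : ∃ i, (n1 + 11) % 12 = i := ⟨_, rfl⟩
  obtain ⟨i2, e2⟩ : ∃ i, (n2 + 11) % 12 = i := ⟨_, rfl⟩
  obtain ⟨i3, e3⟩ : ∃ i, (n3 + 11) % 12 = i := ⟨_, rfl⟩
  obtain ⟨i4, e4⟩ : ∃ i, (n4 + 11) % 12 = i := ⟨_, rfl⟩
  have l1 : i1 < base.length := by omega
  have l2 : i2 < base.length := by omega
  have l3 : i3 < base.length := by omega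
  have l4 : i4 < base.length := by omega
  have c1 := allSuf_get hc i1 l1
  have c2 := allSuf_get c1 (i2 - i1) (by rw [List.length_drop]; omega)
  have c3 := allSuf_get c2 (i3 - i2) (by rw [List.length_drop, List.length_drop]; omega)
  simp only [List.getElem_drop, List.drop_drop,
    show i1 + (i2 - i1) = i2 by omega, show i2 + (i3 - i2) = i3 by omega] at c3
  have hm : base[i4] ∈ base.drop i3 := by
    rw [List.mem_iff_getElem]
    exact ⟨i4 - i3, by rw [List.length_drop]; omega, by
      simp only [List.getElem_drop, show i3 + (i4 - i3) = i4 by omega]⟩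
  have c4 := allL_mem c3 _ hm
  exact S0 n1 n2 n3 n4 a _ _ _ _ 11 ha le_rfl (Nat.modEq_one) (base_rel n1 i1 l1 e1)
    (base_rel n2 i2 l2 e2) (base_rel n3 i3 l3 e3) (base_rel n4 i4 l4 e4) he c4

theorem large_case (n1 n2 n3 n4 a : ℕ) (ha : 11 ≤ a)
    (he : Nat.fib n1 + Nat.fib n2 + Nat.fib n3 + Nat.fib n4 = 2 ^ a) : False := by
  have A1 : ∀ n1 n2 n3 n4 : ℕ, (n2 + 11) % 12 ≤ (n3 + 11) % 12 → (n3 + 11) % 12 ≤ (n4 + 11) % 12 →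
      Nat.fib n1 + Nat.fib n2 + Nat.fib n3 + Nat.fib n4 = 2 ^ a → False := by
    intro n1 n2 n3 n4 h23 h34 he
    rcases le_total ((n1 + 11) % 12) ((n2 + 11) % 12) with h | h
    · exact sorted_case n1 n2 n3 n4 a ha h h23 h34 he
    rcases le_total ((n1 + 11) % 12) ((n3 + 11) % 12) with h' | h'
    · exact sorted_case n2 n1 n3 n4 a ha h h' h34 (by omega)
    rcases le_total ((n1 + 11) % 12) ((n4 + 11) % 12) with h'' | h''
    · exact sorted_case n2 n3 n1 n4 a ha h23 h' h'' (by omega)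
    · exact sorted_case n2 n3 n4 n1 a ha h23 h34 h'' (by omega)
  have A2 : ∀ n1 n2 n3 n4 : ℕ, (n3 + 11) % 12 ≤ (n4 + 11) % 12 →
      Nat.fib n1 + Nat.fib n2 + Nat.fib n3 + Nat.fib n4 = 2 ^ a → False := by
    intro n1 n2 n3 n4 h34 he
    rcases le_total ((n2 + 11) % 12) ((n3 + 11) % 12) with h | h
    · exact A1 n1 n2 n3 n4 h h34 he
    rcases le_total ((n2 + 11) % 12) ((n4 + 11) % 12) with h' | h'
    · exact A1 n1 n3 n2 n4 h h' (by omega)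
    · exact A1 n1 n3 n4 n2 h34 h' (by omega)
  rcases le_total ((n3 + 11) % 12) ((n4 + 11) % 12) with h | h
  · exact A2 n1 n2 n3 n4 h he
  · exact A2 n1 n2 n4 n3 h (by omega)

def sols : List (ℕ × ℕ × ℕ × ℕ × ℕ) := [
        (2,2,2,2,2), (3,3,3,3,3), (5,2,2,2,3), (7,2,2,2,4), (4,4,2,2,3),
        (13,8,2,2,8), (4,3,3,2,3), (6,5,3,2,4), (8,6,3,2,5), (16,9,3,2,10),
        (10,5,4,2,6), (5,5,5,2,4), (8,5,5,2,5), (7,7,5,2,5), (9,8,6,2,6),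
        (8,8,8,2,6), (10,5,3,3,6), (6,4,4,3,4), (11,9,4,3,7), (13,7,6,3,8),
        (12,11,8,3,8), (12,10,10,3,8), (10,4,4,4,6), (5,5,4,4,4), (8,5,4,4,5),
        (7,7,4,4,5), (7,6,6,4,5), (16,8,7,4,10), (15,14,9,4,10), (13,7,5,5,8),
        (11,8,7,5,7), (10,10,7,5,7), (10,9,9,5,7), (16,8,6,6,10), (11,7,7,7,7),
        (6,6,6,6,5)]

theorem sols_ok : ∀ t ∈ sols, Nat.fib t.1 + Nat.fib t.2.1 + Nat.fib t.2.2.1 + Nat.fib t.2.2.2.1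
    = 2 ^ t.2.2.2.2 := by decide +kernel

noncomputable def ok (n1 n2 n3 n4 : ℕ) : Bool :=
  force (Nat.fib n1 + Nat.fib n2 + Nat.fib n3 + Nat.fib n4) fun s =>
  cond (Nat.ble 2 n4 && Nat.beq s (Nat.pow 2 (Nat.log2 s)) && Nat.ble s 1024 && Nat.ble 2 s)
    (decide ((n1, n2, n3, n4, Nat.log2 s) ∈ sols)) true

theorem small_all : ∀ n1 < 17, ∀ n2 < n1 + 1, ∀ n3 < n2 + 1, ∀ n4 < n3 + 1,
    ok n1 n2 n3 n4 = true := by decide +kernel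

theorem small_ok (a : ℕ) (ha : a < 11) (n1 : ℕ) (h1 : n1 < 17) (n2 : ℕ) (h2 : n2 < n1 + 1)
    (n3 : ℕ) (h3 : n3 < n2 + 1) (n4 : ℕ) (h4 : n4 < n3 + 1) (h5 : 2 ≤ n4) (h6 : 1 ≤ a)
    (he : Nat.fib n1 + Nat.fib n2 + Nat.fib n3 + Nat.fib n4 = 2 ^ a) :
    (n1, n2, n3, n4, a) ∈ sols := by
  have h := small_all n1 h1 n2 h2 n3 h3 n4 h4
  unfold ok at h
  have b1 : 2 ^ a ≤ 2 ^ 10 := Nat.pow_le_pow_right (by norm_num) (by omega)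
  have b2 : 2 ^ 1 ≤ 2 ^ a := Nat.pow_le_pow_right (show 0 < 2 by norm_num) h6
  rw [force_eq, he, Nat.log2_two_pow, show (1024 : ℕ) = 2 ^ 10 from rfl, show Nat.pow 2 a = 2 ^ a from rfl, Nat.beq_refl,
    Nat.ble_eq_true_of_le h5, Nat.ble_eq_true_of_le b1, show Nat.ble 2 (2 ^ a) = true from Nat.ble_eq_true_of_le b2] at h
  exact of_decide_eq_true h

end PowFib

/-- Powers of two which are sums of four Fibonacci numbers: complete list of
solutions of `F_{n1} + F_{n2} + F_{n3} + F_{n4} = 2^a` with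
`n1 ≥ n2 ≥ n3 ≥ n4 ≥ 2` and `a ≥ 1`. -/
theorem powers_of_two_sums_of_four_fibonacci
    (n1 n2 n3 n4 a : ℕ) (h12 : n2 ≤ n1) (h23 : n3 ≤ n2) (h34 : n4 ≤ n3)
    (h4 : 2 ≤ n4) (ha : 1 ≤ a) :
    Nat.fib n1 + Nat.fib n2 + Nat.fib n3 + Nat.fib n4 = 2 ^ a ↔
      (n1, n2, n3, n4, a) ∈ ([
        (2,2,2,2,2), (3,3,3,3,3), (5,2,2,2,3), (7,2,2,2,4), (4,4,2,2,3),
        (13,8,2,2,8), (4,3,3,2,3), (6,5,3,2,4), (8,6,3,2,5), (16,9,3,2,10),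
        (10,5,4,2,6), (5,5,5,2,4), (8,5,5,2,5), (7,7,5,2,5), (9,8,6,2,6),
        (8,8,8,2,6), (10,5,3,3,6), (6,4,4,3,4), (11,9,4,3,7), (13,7,6,3,8),
        (12,11,8,3,8), (12,10,10,3,8), (10,4,4,4,6), (5,5,4,4,4), (8,5,4,4,5),
        (7,7,4,4,5), (7,6,6,4,5), (16,8,7,4,10), (15,14,9,4,10), (13,7,5,5,8),
        (11,8,7,5,7), (10,10,7,5,7), (10,9,9,5,7), (16,8,6,6,10), (11,7,7,7,7),
        (6,6,6,6,5)] : List (ℕ × ℕ × ℕ × ℕ × ℕ)) := by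
  change _ ↔ (n1, n2, n3, n4, a) ∈ PowFib.sols
  constructor
  · intro h
    rcases Nat.lt_or_ge a 11 with ha' | ha'
    · have hn : n1 < 17 := by
        by_contra hc
        have h1 : Nat.fib 17 ≤ Nat.fib n1 := Nat.fib_mono (by omega)
        have h2 : 2 ^ a ≤ 2 ^ 10 := Nat.pow_le_pow_right (by norm_num) (by omega)
        have h3 : Nat.fib 17 = 1597 := by decide +kernel
        omega
      exact (PowFib.small_ok a ha' n1 hn n2 (by omega) n3 (by omega) n4 (by omega)
        h4 ha h)
    · exact (PowFib.large_case n1 n2 n3 n4 a ha' h).elim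
  · intro h
    exact PowFib.sols_ok _ h
end

section
/- If positive integers n1 ≥ n2 ≥ n3 ≥ n4 and a satisfy F_{n1} + F_{n2} + F_{n3} + F_{n4} = 2^a, then |1 − 2^a · α^{−n1} · √5| < 9 / α^{n1 − n2}. -/
/-- First linear form estimate: if positive integers `n1 ≥ n2 ≥ n3 ≥ n4` and `a`
satisfy `F_{n1} + F_{n2} + F_{n3} + F_{n4} = 2^a`, then
`|1 − 2^a · α^{−n1} · √5| < 9 / α^{n1 − n2}` where `α = (1+√5)/2`. -/
theorem first_linear_form_estimate
    (n1 n2 n3 n4 a : ℕ) (hn4 : 0 < n4) (ha : 0 < a)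
    (h12 : n2 ≤ n1) (h23 : n3 ≤ n2) (h34 : n4 ≤ n3)
    (h : Nat.fib n1 + Nat.fib n2 + Nat.fib n3 + Nat.fib n4 = 2 ^ a) :
    |1 - (2 : ℝ) ^ a * ((1 + Real.sqrt 5) / 2) ^ (-(n1 : ℤ)) * Real.sqrt 5| <
      9 / ((1 + Real.sqrt 5) / 2) ^ (n1 - n2) := by
  have hφ : (1 + Real.sqrt 5) / 2 = Real.goldenRatio := rfl
  rw [hφ]
  have hp := Real.goldenRatio_pos
  have h1 := Real.one_lt_goldenRatio
  have h5 : (0 : ℝ) < Real.sqrt 5 := by positivity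
  have hψ : ∀ n : ℕ, |Real.goldenConj ^ n| ≤ 1 := by
    intro n
    rw [abs_pow]
    apply pow_le_one₀ (abs_nonneg _)
    rw [abs_le]
    exact ⟨Real.neg_one_lt_goldenConj.le, by linarith [Real.goldenConj_neg]⟩
  have hF : ∀ n : ℕ, (Nat.fib n : ℝ) * Real.sqrt 5
      = Real.goldenRatio ^ n - Real.goldenConj ^ n := by
    intro n
    rw [Real.coe_fib_eq]
    field_simp
  have hc : (2 : ℝ) ^ a = Nat.fib n1 + Nat.fib n2 + Nat.fib n3 + Nat.fib n4 := by
    exact_mod_cast h.symm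
  have hB : (1 : ℝ) < Real.goldenRatio ^ n2 := one_lt_pow₀ h1 (by omega)
  have h3 : Real.goldenRatio ^ n3 ≤ Real.goldenRatio ^ n2 := pow_le_pow_right₀ h1.le h23
  have h4 : Real.goldenRatio ^ n4 ≤ Real.goldenRatio ^ n2 :=
    pow_le_pow_right₀ h1.le (h34.trans h23)
  have hA : 0 < Real.goldenRatio ^ n1 := by positivity
  have hR : 9 / Real.goldenRatio ^ (n1 - n2)
      = 9 * Real.goldenRatio ^ n2 / Real.goldenRatio ^ n1 := by
    have : Real.goldenRatio ^ n1 = Real.goldenRatio ^ (n1 - n2) * Real.goldenRatio ^ n2 := by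
      rw [← pow_add, Nat.sub_add_cancel h12]
    rw [this]
    field_simp
  have hL : 1 - (2 : ℝ) ^ a * Real.goldenRatio ^ (-(n1 : ℤ)) * Real.sqrt 5
      = (Real.goldenRatio ^ n1 - 2 ^ a * Real.sqrt 5) / Real.goldenRatio ^ n1 := by
    rw [zpow_neg, zpow_natCast]
    field_simp
  rw [hL, hR, abs_div, abs_of_pos hA]
  apply div_lt_div_of_pos_right _ hA
  have e : (2 : ℝ) ^ a * Real.sqrt 5 = Nat.fib n1 * Real.sqrt 5 + Nat.fib n2 * Real.sqrt 5
      + Nat.fib n3 * Real.sqrt 5 + Nat.fib n4 * Real.sqrt 5 := by rw [hc]; ring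
  rw [e, hF, hF, hF, hF]
  have a1 := abs_le.1 (hψ n1)
  have a2 := abs_le.1 (hψ n2)
  have a3 := abs_le.1 (hψ n3)
  have a4 := abs_le.1 (hψ n4)
  have p3 : 0 < Real.goldenRatio ^ n3 := by positivity
  have p4 : 0 < Real.goldenRatio ^ n4 := by positivity
  rw [abs_lt]
  constructor <;> linarith [a1.1, a1.2, a2.1, a2.2, a3.1, a3.2, a4.1, a4.2]
end

section
/- There are no positive integers n and a such that α^n = 2^a · √5. -/
/-- There are no positive integers `n` and `a` with `α^n = 2^a·√5`,
where `α = (1+√5)/2`. -/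
theorem no_power_of_alpha_eq_power_of_two_mul_sqrt_five :
    ¬ ∃ (n a : ℕ), 0 < n ∧ 0 < a ∧
      ((1 + Real.sqrt 5) / 2) ^ n = (2 : ℝ) ^ a * Real.sqrt 5 := by
  rintro ⟨n, a, hn, -, h⟩
  have h1 := Real.fib_succ_sub_goldenConj_mul_fib n
  unfold Real.goldenRatio Real.goldenConj at h1
  rw [h] at h1
  have hle : (Nat.fib n : ℝ) ≤ Nat.fib (n + 1) := by exact_mod_cast Nat.fib_le_fib_succ
  have hpos : (0 : ℝ) < Nat.fib n := by exact_mod_cast Nat.fib_pos.2 hn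
  have h2 : (2 * Nat.fib (n + 1) - Nat.fib n : ℝ) = (2 * 2 ^ a - Nat.fib n) * Real.sqrt 5 := by
    linarith
  have hk : (2 * 2 ^ a - Nat.fib n : ℝ) ≠ 0 := by
    intro h0
    rw [h0, zero_mul] at h2
    linarith
  have hirr : Irrational (Real.sqrt 5) := by
    simpa using Nat.Prime.irrational_sqrt (by norm_num : Nat.Prime 5)
  apply hirr
  refine ⟨(2 * Nat.fib (n + 1) - Nat.fib n) / (2 * 2 ^ a - Nat.fib n), ?_⟩
  push_cast
  rw [div_eq_iff hk, h2]
  ring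
end

section
/- There are no positive integers n1, n2, n3, n4 and a such that α^{n1} + α^{n2} + α^{n3} + α^{n4} = 2^a · √5. -/
theorem alpha_pow_aux (n : ℕ) : ∃ p q : ℚ, 0 < p ∧ 0 ≤ q ∧
    ((1 + Real.sqrt 5) / 2) ^ n = (p : ℝ) + q * Real.sqrt 5 := by
  induction n with
  | zero => exact ⟨1, 0, by norm_num, by norm_num, by simp⟩
  | succ n ih =>
    obtain ⟨p, q, hp, hq, h⟩ := ih
    refine ⟨(p + 5 * q) / 2, (p + q) / 2, by positivity, by positivity, ?_⟩
    have h5 : Real.sqrt 5 * Real.sqrt 5 = 5 := Real.mul_self_sqrt (by norm_num)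
    rw [pow_succ, h]
    push_cast
    linear_combination (q / 2 : ℝ) * h5

/-- There are no positive integers `n1`, `n2`, `n3`, `n4` and `a` with
`α^{n1} + α^{n2} + α^{n3} + α^{n4} = 2^a·√5`, where `α = (1+√5)/2`. -/
theorem no_sum_of_four_powers_of_alpha_eq_power_of_two_mul_sqrt_five :
    ¬ ∃ (n1 n2 n3 n4 a : ℕ), 0 < n1 ∧ 0 < n2 ∧ 0 < n3 ∧ 0 < n4 ∧ 0 < a ∧
      ((1 + Real.sqrt 5) / 2) ^ n1 + ((1 + Real.sqrt 5) / 2) ^ n2 +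
        ((1 + Real.sqrt 5) / 2) ^ n3 + ((1 + Real.sqrt 5) / 2) ^ n4 =
          (2 : ℝ) ^ a * Real.sqrt 5 := by
  rintro ⟨n1, n2, n3, n4, a, -, -, -, -, -, h⟩
  obtain ⟨p1, q1, hp1, -, h1⟩ := alpha_pow_aux n1
  obtain ⟨p2, q2, hp2, -, h2⟩ := alpha_pow_aux n2
  obtain ⟨p3, q3, hp3, -, h3⟩ := alpha_pow_aux n3
  obtain ⟨p4, q4, hp4, -, h4⟩ := alpha_pow_aux n4
  rw [h1, h2, h3, h4] at h
  have hP : 0 < p1 + p2 + p3 + p4 := by positivity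
  have hP' : (0 : ℝ) < p1 + p2 + p3 + p4 := by exact_mod_cast hP
  have hirr : Irrational (Real.sqrt 5) := by
    simpa using Nat.Prime.irrational_sqrt (p := 5) (by norm_num)
  have key : ((2 : ℝ) ^ a - (q1 + q2 + q3 + q4)) * Real.sqrt 5 = p1 + p2 + p3 + p4 := by
    linear_combination -h
  have hne : ((2 : ℝ) ^ a - (q1 + q2 + q3 + q4)) ≠ 0 := by
    intro h0
    rw [h0, zero_mul] at key
    linarith
  apply hirr
  refine ⟨(p1 + p2 + p3 + p4) / (2 ^ a - (q1 + q2 + q3 + q4)), ?_⟩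
  push_cast
  rw [← key]
  exact mul_div_cancel_left₀ _ hne
end

section
/- If positive integers n1 ≥ n2 ≥ n3 ≥ n4 and a satisfy F_{n1} + F_{n2} + F_{n3} + F_{n4} = 2^a with n2 ≥ 5, then |1 − 2^a · α^{−n1} · √5 · (1 + α^{n2−n1})^{−1}| < 6 / α^{n1 − n3}. -/
/-- Second linear form estimate: if positive integers `n1 ≥ n2 ≥ n3 ≥ n4` and
`a` satisfy `F_{n1} + F_{n2} + F_{n3} + F_{n4} = 2^a` with `n2 ≥ 5`, then
`|1 − 2^a · α^{−n1} · √5 · (1 + α^{n2−n1})⁻¹| < 6 / α^{n1 − n3}`. -/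
theorem second_linear_form_estimate
    (n1 n2 n3 n4 a : ℕ) (hn4 : 0 < n4) (ha : 0 < a) (hn2 : 5 ≤ n2)
    (h12 : n2 ≤ n1) (h23 : n3 ≤ n2) (h34 : n4 ≤ n3)
    (h : Nat.fib n1 + Nat.fib n2 + Nat.fib n3 + Nat.fib n4 = 2 ^ a) :
    |1 - (2 : ℝ) ^ a * ((1 + Real.sqrt 5) / 2) ^ (-(n1 : ℤ)) * Real.sqrt 5 *
        (1 + ((1 + Real.sqrt 5) / 2) ^ ((n2 : ℤ) - (n1 : ℤ)))⁻¹| <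
      6 / ((1 + Real.sqrt 5) / 2) ^ (n1 - n3) := by
  have hphi : (1 + Real.sqrt 5) / 2 = Real.goldenRatio := rfl
  rw [hphi]
  have h1 := Real.one_lt_goldenRatio
  have hs : (0:ℝ) < Real.sqrt 5 := by positivity
  have key : ∀ n : ℕ, ∃ e : ℝ, |e| ≤ 1 ∧
      Real.sqrt 5 * (Nat.fib n : ℝ) = Real.goldenRatio ^ n - e := by
    intro n
    refine ⟨Real.goldenConj ^ n, ?_, ?_⟩
    · rw [abs_pow]
      apply pow_le_one₀ (abs_nonneg _)
      rw [abs_le]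
      constructor
      · linarith [Real.neg_one_lt_goldenConj]
      · linarith [Real.goldenConj_neg]
    · rw [Real.coe_fib_eq]
      field_simp
  have hR : (Nat.fib n1 : ℝ) + Nat.fib n2 + Nat.fib n3 + Nat.fib n4 = 2 ^ a := by
    exact_mod_cast h
  obtain ⟨e1, he1, hf1⟩ := key n1
  obtain ⟨e2, he2, hf2⟩ := key n2
  obtain ⟨e3, he3, hf3⟩ := key n3
  obtain ⟨e4, he4, hf4⟩ := key n4
  have hp : (0:ℝ) < Real.goldenRatio := by linarith
  generalize Real.goldenRatio = φ at *
  have hp1 : 0 < φ ^ n1 := by positivity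
  have hp2 : 0 < φ ^ n2 := by positivity
  have hp3 : 1 < φ ^ n3 := one_lt_pow₀ h1 (by omega)
  have hp4 : 1 ≤ φ ^ n4 := one_le_pow₀ h1.le
  have h43 : φ ^ n4 ≤ φ ^ n3 := pow_le_pow_right₀ h1.le h34
  have hexp : φ ^ (n1 - n3) = φ ^ n1 / φ ^ n3 := by
    rw [eq_div_iff (by positivity), ← pow_add]
    congr 1
    omega
  have hE : 1 - (2 : ℝ) ^ a * φ ^ (-(n1 : ℤ)) * Real.sqrt 5 *
      (1 + φ ^ ((n2 : ℤ) - (n1 : ℤ)))⁻¹ =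
      (φ ^ n1 + φ ^ n2 - Real.sqrt 5 * 2 ^ a) / (φ ^ n1 + φ ^ n2) := by
    rw [zpow_sub₀ hp.ne', zpow_neg, zpow_natCast, zpow_natCast]
    field_simp
  have hN : φ ^ n1 + φ ^ n2 - Real.sqrt 5 * 2 ^ a =
      e1 + e2 + e3 + e4 - φ ^ n3 - φ ^ n4 := by
    rw [← hR]
    linarith
  rw [hE, hN, hexp, abs_div, abs_of_pos (by positivity : 0 < φ ^ n1 + φ ^ n2)]
  have hb : |e1 + e2 + e3 + e4 - φ ^ n3 - φ ^ n4| < 6 * φ ^ n3 := by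
    rw [abs_le] at he1 he2 he3 he4
    rw [abs_lt]
    constructor <;> linarith
  rw [div_lt_iff₀ (by positivity), div_div_eq_mul_div, div_mul_eq_mul_div,
    lt_div_iff₀ hp1]
  have hm : 0 < 6 * φ ^ n3 * φ ^ n2 := by positivity
  nlinarith [mul_lt_mul_of_pos_right hb hp1]
end

section
/- If positive integers n1 ≥ n2 ≥ n3 ≥ n4 and a satisfy F_{n1} + F_{n2} + F_{n3} + F_{n4} = 2^a with n1 > 350, then |1 − 2^a · α^{−n1} · √5 · (1 + α^{n2−n1} + α^{n3−n1})^{−1}| < 3 / α^{n1 − n4}. -/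
/-- Third linear form estimate: if positive integers `n1 ≥ n2 ≥ n3 ≥ n4` and
`a` satisfy `F_{n1} + F_{n2} + F_{n3} + F_{n4} = 2^a` with `n1 > 350`, then
`|1 − 2^a · α^{−n1} · √5 · (1 + α^{n2−n1} + α^{n3−n1})⁻¹| < 3 / α^{n1 − n4}`. -/
theorem third_linear_form_estimate
    (n1 n2 n3 n4 a : ℕ) (hn4 : 0 < n4) (ha : 0 < a) (hn1 : 350 < n1)
    (h12 : n2 ≤ n1) (h23 : n3 ≤ n2) (h34 : n4 ≤ n3)
    (h : Nat.fib n1 + Nat.fib n2 + Nat.fib n3 + Nat.fib n4 = 2 ^ a) :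
    |1 - (2 : ℝ) ^ a * ((1 + Real.sqrt 5) / 2) ^ (-(n1 : ℤ)) * Real.sqrt 5 *
        (1 + ((1 + Real.sqrt 5) / 2) ^ ((n2 : ℤ) - (n1 : ℤ)) +
          ((1 + Real.sqrt 5) / 2) ^ ((n3 : ℤ) - (n1 : ℤ)))⁻¹| <
      3 / ((1 + Real.sqrt 5) / 2) ^ (n1 - n4) := by
  have hphi : (1 + Real.sqrt 5) / 2 = Real.goldenRatio := rfl
  rw [hphi]
  have hp := Real.goldenRatio_pos
  have h1 := Real.one_lt_goldenRatio
  have h2 := Real.goldenRatio_lt_two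
  have hne := Real.goldenRatio_ne_zero
  have h5 : Real.sqrt 5 ≠ 0 := by positivity
  have hb : ∀ k : ℕ, 0 < k → |Real.goldenConj ^ k| ≤ Real.goldenRatio - 1 := by
    intro k hk
    have e : |Real.goldenConj| = Real.goldenRatio - 1 := by
      rw [abs_of_neg Real.goldenConj_neg, ← Real.one_sub_goldenConj]; ring
    rw [abs_pow, e]
    exact pow_le_of_le_one (by linarith) (by linarith) (by omega)
  have hf : ∀ k : ℕ, Real.sqrt 5 * (Nat.fib k : ℝ) =
      Real.goldenRatio ^ k - Real.goldenConj ^ k := by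
    intro k
    rw [Real.coe_fib_eq]; field_simp
  have hR : Real.sqrt 5 * (2 : ℝ) ^ a = Real.sqrt 5 * (Nat.fib n1 : ℝ) +
      Real.sqrt 5 * (Nat.fib n2 : ℝ) + Real.sqrt 5 * (Nat.fib n3 : ℝ) +
      Real.sqrt 5 * (Nat.fib n4 : ℝ) := by
    have : (Nat.fib n1 : ℝ) + Nat.fib n2 + Nat.fib n3 + Nat.fib n4 = 2 ^ a := by
      exact_mod_cast h
    rw [← this]; ring
  simp only [hf] at hR
  have b1 := abs_le.mp (hb n1 (by omega))
  have b2 := abs_le.mp (hb n2 (by omega))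
  have b3 := abs_le.mp (hb n3 (by omega))
  have b4 := abs_le.mp (hb n4 (by omega))
  have hg : Real.goldenRatio ≤ Real.goldenRatio ^ n4 :=
    le_self_pow₀ h1.le (by omega)
  have p1 : 0 < Real.goldenRatio ^ n1 := by positivity
  have p2 : 0 < Real.goldenRatio ^ n2 := by positivity
  have p3 : 0 < Real.goldenRatio ^ n3 := by positivity
  have p4 : 0 < Real.goldenRatio ^ n4 := by positivity
  have hS : 0 < Real.goldenRatio ^ n1 + Real.goldenRatio ^ n2 + Real.goldenRatio ^ n3 := by
    positivity
  have hL : 1 - (2 : ℝ) ^ a * Real.goldenRatio ^ (-(n1 : ℤ)) * Real.sqrt 5 *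
        (1 + Real.goldenRatio ^ ((n2 : ℤ) - (n1 : ℤ)) +
          Real.goldenRatio ^ ((n3 : ℤ) - (n1 : ℤ)))⁻¹ =
      (Real.goldenRatio ^ n1 + Real.goldenRatio ^ n2 + Real.goldenRatio ^ n3
        - Real.sqrt 5 * 2 ^ a) /
      (Real.goldenRatio ^ n1 + Real.goldenRatio ^ n2 + Real.goldenRatio ^ n3) := by
    rw [zpow_sub₀ hne, zpow_sub₀ hne, zpow_neg, zpow_natCast, zpow_natCast, zpow_natCast]
    have e : 1 + Real.goldenRatio ^ n2 / Real.goldenRatio ^ n1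
        + Real.goldenRatio ^ n3 / Real.goldenRatio ^ n1 =
        (Real.goldenRatio ^ n1 + Real.goldenRatio ^ n2 + Real.goldenRatio ^ n3) /
          Real.goldenRatio ^ n1 := by
      rw [add_div, add_div, div_self p1.ne']
    rw [e, inv_div, sub_div, div_self hS.ne']
    congr 1
    generalize Real.goldenRatio ^ n1 + Real.goldenRatio ^ n2 + Real.goldenRatio ^ n3 = S at *
    generalize Real.goldenRatio ^ n1 = x at *
    have := p1.ne'
    have := hS.ne'
    field_simp
  have hD : (3 : ℝ) / Real.goldenRatio ^ (n1 - n4) =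
      3 * Real.goldenRatio ^ n4 / Real.goldenRatio ^ n1 := by
    rw [← pow_sub_mul_pow Real.goldenRatio (show n4 ≤ n1 by omega)]
    rw [mul_div_mul_right _ _ p4.ne']
  rw [hL, hD, abs_div, abs_of_pos hS]
  have hN : |Real.goldenRatio ^ n1 + Real.goldenRatio ^ n2 + Real.goldenRatio ^ n3
        - Real.sqrt 5 * 2 ^ a| < 3 * Real.goldenRatio ^ n4 := by
    rw [hR, abs_lt]
    constructor <;> linarith [b1.1, b1.2, b2.1, b2.2, b3.1, b3.2, b4.1, b4.2]
  exact div_lt_div₀ hN (by linarith) (by positivity) p1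
end

section
/- If positive integers n1 ≥ n2 ≥ n3 ≥ n4 and a satisfy F_{n1} + F_{n2} + F_{n3} + F_{n4} = 2^a with n1 > 350, then |1 − 2^a · α^{−n1} · √5 · (1 + α^{n2−n1} + α^{n3−n1} + α^{n4−n1})^{−1}| < 2 / α^{n1}. -/
/-- Fourth linear form estimate: if positive integers `n1 ≥ n2 ≥ n3 ≥ n4` and
`a` satisfy `F_{n1} + F_{n2} + F_{n3} + F_{n4} = 2^a` with `n1 > 350`, then
`|1 − 2^a · α^{−n1} · √5 · (1 + α^{n2−n1} + α^{n3−n1} + α^{n4−n1})⁻¹| < 2 / α^{n1}`. -/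
theorem fourth_linear_form_estimate
    (n1 n2 n3 n4 a : ℕ) (hn4 : 0 < n4) (ha : 0 < a) (hn1 : 350 < n1)
    (h12 : n2 ≤ n1) (h23 : n3 ≤ n2) (h34 : n4 ≤ n3)
    (h : Nat.fib n1 + Nat.fib n2 + Nat.fib n3 + Nat.fib n4 = 2 ^ a) :
    |1 - (2 : ℝ) ^ a * ((1 + Real.sqrt 5) / 2) ^ (-(n1 : ℤ)) * Real.sqrt 5 *
        (1 + ((1 + Real.sqrt 5) / 2) ^ ((n2 : ℤ) - (n1 : ℤ)) +
          ((1 + Real.sqrt 5) / 2) ^ ((n3 : ℤ) - (n1 : ℤ)) +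
          ((1 + Real.sqrt 5) / 2) ^ ((n4 : ℤ) - (n1 : ℤ)))⁻¹| <
      2 / ((1 + Real.sqrt 5) / 2) ^ n1 := by
  have h5 : Real.sqrt 5 ^ 2 = 5 := Real.sq_sqrt (by norm_num)
  have h5p : 0 < Real.sqrt 5 := by positivity
  have h5l : Real.sqrt 5 < 2.237 := by
    rw [Real.sqrt_lt' (by norm_num)]; norm_num
  have h5g : 1 < Real.sqrt 5 := by nlinarith
  have bin : ∀ n : ℕ, (Nat.fib n : ℝ) * Real.sqrt 5 =
      ((1 + Real.sqrt 5) / 2) ^ n - ((1 - Real.sqrt 5) / 2) ^ n := by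
    intro n
    rw [Real.coe_fib_eq, Real.goldenRatio, Real.goldenConj]
    field_simp
  have hR : ((2 : ℝ) ^ a) = Nat.fib n1 + Nat.fib n2 + Nat.fib n3 + Nat.fib n4 := by
    exact_mod_cast h.symm
  have e1 := bin n1
  have e2 := bin n2
  have e3 := bin n3
  have e4 := bin n4
  have hb : |(1 - Real.sqrt 5) / 2| ≤ 0.6185 := by
    rw [abs_le]; constructor <;> linarith
  have small : ∀ n : ℕ, 0 < n → |((1 - Real.sqrt 5) / 2) ^ n| ≤ 0.6185 := by
    intro n hn
    rw [abs_pow]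
    exact (pow_le_of_le_one (abs_nonneg _) (by linarith) hn.ne').trans hb
  have tiny : |((1 - Real.sqrt 5) / 2) ^ n1| ≤ 0.1 := by
    rw [abs_pow]
    calc |(1 - Real.sqrt 5) / 2| ^ n1 ≤ |(1 - Real.sqrt 5) / 2| ^ 5 :=
          pow_le_pow_of_le_one (abs_nonneg _) (by linarith) (by omega)
      _ ≤ 0.6185 ^ 5 := by gcongr
      _ ≤ 0.1 := by norm_num
  have t2 := small n2 (by omega)
  have t3 := small n3 (by omega)
  have t4 := small n4 (by omega)
  have hα : 0 < (1 + Real.sqrt 5) / 2 := by positivity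
  generalize (1 + Real.sqrt 5) / 2 = α at *
  generalize (1 - Real.sqrt 5) / 2 = β at *
  rw [zpow_sub₀ hα.ne', zpow_sub₀ hα.ne', zpow_sub₀ hα.ne', zpow_neg]
  simp only [zpow_natCast]
  have p1 : 0 < α ^ n1 := by positivity
  have p2 : 0 < α ^ n2 := by positivity
  have p3 : 0 < α ^ n3 := by positivity
  have p4 : 0 < α ^ n4 := by positivity
  have key : (2 : ℝ) ^ a * Real.sqrt 5 = (α ^ n1 + α ^ n2 + α ^ n3 + α ^ n4) -
      (β ^ n1 + β ^ n2 + β ^ n3 + β ^ n4) := by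
    rw [hR]; linarith
  have hT : |β ^ n1 + β ^ n2 + β ^ n3 + β ^ n4| < 2 := by
    rw [abs_le] at tiny t2 t3 t4
    rw [abs_lt]; constructor <;> linarith
  have hE : 1 - (2 : ℝ) ^ a * (α ^ n1)⁻¹ * Real.sqrt 5 *
      (1 + α ^ n2 / α ^ n1 + α ^ n3 / α ^ n1 + α ^ n4 / α ^ n1)⁻¹ =
      (β ^ n1 + β ^ n2 + β ^ n3 + β ^ n4) / (α ^ n1 + α ^ n2 + α ^ n3 + α ^ n4) := by
    have : 1 + α ^ n2 / α ^ n1 + α ^ n3 / α ^ n1 + α ^ n4 / α ^ n1 =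
      (α ^ n1 + α ^ n2 + α ^ n3 + α ^ n4) / α ^ n1 := by field_simp
    rw [this, inv_div]
    have hS : α ^ n1 + α ^ n2 + α ^ n3 + α ^ n4 ≠ 0 := by positivity
    generalize α ^ n1 + α ^ n2 + α ^ n3 + α ^ n4 = S at *
    field_simp
    linarith
  rw [hE, abs_div, abs_of_pos (by positivity : 0 < α ^ n1 + α ^ n2 + α ^ n3 + α ^ n4)]
  apply div_lt_div₀ hT _ (by norm_num) p1
  linarith
end

section
/- If positive integers n1 ≥ n2 ≥ n3 ≥ n4 and a satisfy F_{n1} + F_{n2} + F_{n3} + F_{n4} = 2^a with n1 ≥ 3, then (n1 − n2)·log α < 2.32 × 10^12 · log n1. -/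
namespace FibPow

noncomputable section

/-- Evaluate `n` to a numeral before passing it on. -/
def force {α : Type} (n : ℕ) (k : ℕ → α) : α :=
  Nat.rec (motive := fun _ => α) (k 0) (fun m _ => k (Nat.succ m)) n

theorem force_eq {α : Type} (n : ℕ) (k : ℕ → α) : force n k = k n := by
  cases n <;> rfl

def sel (c : Bool) (t e : Bool) : Bool :=
  Bool.rec (motive := fun _ => Bool) e t c

theorem sel_true {c t : Bool} (h : sel c t true = true) (hc : c = true) : t = true := by
  subst hc; exact h

theorem sel_false {c t : Bool} (h : sel c t false = true) : c = true ∧ t = true := by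
  cases c
  · exact absurd h (by simp [sel])
  · exact ⟨rfl, h⟩

theorem beq_of_eq {x y : ℕ} (h : x = y) : Nat.beq x y = true := by
  subst h; exact Nat.beq_refl x

inductive PL : Type
  | nil : PL
  | cons (s x : ℕ) (t : PL) : PL

def PL.Mem (s x : ℕ) (l : PL) : Prop :=
  PL.rec (motive := fun _ => Prop) False (fun s' x' _ ih => (s = s' ∧ x = x') ∨ ih) l

def allP (l : PL) (f : ℕ → ℕ → Bool) : Bool :=
  PL.rec (motive := fun _ => Bool) true (fun s x _ ih => sel (f s x) ih false) l

theorem allP_spec {l : PL} {f : ℕ → ℕ → Bool} (h : allP l f = true) {s x : ℕ}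
    (hm : PL.Mem s x l) : f s x = true := by
  induction l with
  | nil => exact hm.elim
  | cons s' x' t ih =>
    have h' := sel_false (c := f s' x') (t := allP t f) h
    rcases hm with ⟨rfl, rfl⟩ | hm
    · exact h'.1
    · exact ih h'.2 hm

def allLt (q : ℕ) (f : ℕ → Bool) : Bool :=
  Nat.rec (motive := fun _ => Bool) true (fun j ih => sel (f j) ih false) q

theorem allLt_spec {q : ℕ} {f : ℕ → Bool} (h : allLt q f = true) {j : ℕ} (hj : j < q) :
    f j = true := by
  induction q with
  | zero => omega
  | succ q ih =>
    have h' := sel_false (c := f q) (t := allLt q f) h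
    rcases Nat.lt_succ_iff_lt_or_eq.mp hj with h1 | rfl
    · exact ih h'.2 h1
    · exact h'.1

/-! Tables -/

def goU (M c c0 c1 c2 : ℕ) (n : ℕ) : ℕ → ℕ → ℕ → ℕ → ℕ :=
  Nat.rec (motive := fun _ => ℕ → ℕ → ℕ → ℕ → ℕ) (fun _ _ _ acc => acc)
    (fun _ ih i a b acc =>
      force (Nat.add i 1) fun i' =>
      force (Nat.mod (Nat.add (Nat.mul a c0) (Nat.mul b c1)) M) fun a' =>
      force (Nat.mod (Nat.add (Nat.mul a c1) (Nat.mul b c2)) M) fun b' =>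
      force (Nat.add acc (Nat.shiftLeft (Nat.add (Nat.mul a (Nat.pow 2 c)) b)
        (Nat.mul (Nat.mul 2 c) i))) fun acc' =>
      ih i' a' b' acc') n

def mkU (M c c0 c1 c2 n : ℕ) : ℕ := goU M c c0 c1 c2 n 0 0 (Nat.mod 1 M) 0

def ent (d M c i : ℕ) : ℕ := (Nat.fib (d * i) % M) * 2 ^ c + Nat.fib (d * i + 1) % M

def tab (d M c : ℕ) : ℕ → ℕ
  | 0 => 0
  | n + 1 => tab d M c n + ent d M c n * 2 ^ (2 * c * n)

theorem ent_lt (d M c i : ℕ) (hM : 0 < M) (hc : M ≤ 2 ^ c) : ent d M c i < 2 ^ (2 * c) := by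
  have h1 : Nat.fib (d * i) % M < M := Nat.mod_lt _ hM
  have h2 : Nat.fib (d * i + 1) % M < M := Nat.mod_lt _ hM
  have : (2 : ℕ) ^ (2 * c) = 2 ^ c * 2 ^ c := by rw [two_mul, pow_add]
  rw [this]; unfold ent
  have : (Nat.fib (d * i) % M + 1) * 2 ^ c ≤ 2 ^ c * 2 ^ c :=
    Nat.mul_le_mul_right _ (by omega)
  nlinarith

theorem tab_lt (d M c n : ℕ) (hM : 0 < M) (hc : M ≤ 2 ^ c) :
    tab d M c n < 2 ^ (2 * c * n) := by
  induction n with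
  | zero => simp [tab]
  | succ n ih =>
    have h := ent_lt d M c n hM hc
    have e : (2 : ℕ) ^ (2 * c * (n + 1)) = 2 ^ (2 * c) * 2 ^ (2 * c * n) := by
      rw [← pow_add]; ring_nf
    rw [e, tab]
    have : (ent d M c n + 1) * 2 ^ (2 * c * n) ≤ 2 ^ (2 * c) * 2 ^ (2 * c * n) :=
      Nat.mul_le_mul_right _ h
    nlinarith

theorem tab_get (d M c n i : ℕ) (hM : 0 < M) (hc : M ≤ 2 ^ c) (hi : i < n) :
    tab d M c n / 2 ^ (2 * c * i) % 2 ^ (2 * c) = ent d M c i := by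
  induction n with
  | zero => omega
  | succ n ih =>
    rw [tab]
    rcases Nat.lt_succ_iff_lt_or_eq.mp hi with h1 | rfl
    · obtain ⟨k, rfl⟩ : ∃ k, n = i + 1 + k := ⟨n - (i + 1), by omega⟩
      have e : ent d M c (i + 1 + k) * 2 ^ (2 * c * (i + 1 + k))
          = 2 ^ (2 * c * i) * (2 ^ (2 * c) * (ent d M c (i + 1 + k) * 2 ^ (2 * c * k))) := by
        have : (2 : ℕ) ^ (2 * c * (i + 1 + k)) = 2 ^ (2 * c * i) * 2 ^ (2 * c) * 2 ^ (2 * c * k) := by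
          rw [← pow_add, ← pow_add]; ring_nf
        rw [this]; ring
      rw [e, Nat.add_mul_div_left _ _ (by positivity), Nat.add_mul_mod_self_left]
      exact ih h1
    · rw [Nat.add_mul_div_right _ _ (by positivity),
        Nat.div_eq_of_lt (tab_lt d M c i hM hc), Nat.zero_add,
        Nat.mod_eq_of_lt (ent_lt d M c i hM hc)]

theorem goU_succ (M c c0 c1 c2 n i a b acc : ℕ) :
    goU M c c0 c1 c2 (n + 1) i a b acc
      = goU M c c0 c1 c2 n (i + 1) ((a * c0 + b * c1) % M) ((a * c1 + b * c2) % M)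
        (acc + Nat.shiftLeft (a * 2 ^ c + b) (2 * c * i)) := by
  have : goU M c c0 c1 c2 (n + 1) i a b acc =
      (force (Nat.add i 1) fun i' =>
      force (Nat.mod (Nat.add (Nat.mul a c0) (Nat.mul b c1)) M) fun a' =>
      force (Nat.mod (Nat.add (Nat.mul a c1) (Nat.mul b c2)) M) fun b' =>
      force (Nat.add acc (Nat.shiftLeft (Nat.add (Nat.mul a (Nat.pow 2 c)) b)
        (Nat.mul (Nat.mul 2 c) i))) fun acc' =>
      goU M c c0 c1 c2 n i' a' b' acc') := rfl
  rw [this]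
  simp only [force_eq]
  rfl

theorem goU_eq (d M c n i : ℕ) :
    goU M c (Nat.fib d) (Nat.fib (d + 1)) (Nat.fib (d + 2)) n i
      (Nat.fib ((d + 1) * i) % M) (Nat.fib ((d + 1) * i + 1) % M) (tab (d + 1) M c i)
      = tab (d + 1) M c (i + n) := by
  induction n generalizing i with
  | zero => rfl
  | succ n ih =>
    have h := ih (i + 1)
    have e1 : (Nat.fib ((d + 1) * i) % M * Nat.fib d
        + Nat.fib ((d + 1) * i + 1) % M * Nat.fib (d + 1)) % M
        = Nat.fib ((d + 1) * (i + 1)) % M := by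
      have : (d + 1) * (i + 1) = (d + 1) * i + d + 1 := by ring
      rw [this, Nat.fib_add ((d + 1) * i) d]
      simp [Nat.add_mod, Nat.mul_mod]
    have e2 : (Nat.fib ((d + 1) * i) % M * Nat.fib (d + 1)
        + Nat.fib ((d + 1) * i + 1) % M * Nat.fib (d + 2)) % M
        = Nat.fib ((d + 1) * (i + 1) + 1) % M := by
      have : (d + 1) * (i + 1) + 1 = (d + 1) * i + (d + 1) + 1 := by ring
      rw [this, Nat.fib_add ((d + 1) * i) (d + 1)]
      simp [Nat.add_mod, Nat.mul_mod]
    have e3 : tab (d + 1) M c i + Nat.shiftLeft (Nat.fib ((d + 1) * i) % M * 2 ^ c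
        + Nat.fib ((d + 1) * i + 1) % M) (2 * c * i) = tab (d + 1) M c (i + 1) := by
      change tab (d + 1) M c i + ((Nat.fib ((d + 1) * i) % M * 2 ^ c
        + Nat.fib ((d + 1) * i + 1) % M) <<< (2 * c * i)) = _
      rw [Nat.shiftLeft_eq, tab, ent]
    rw [show i + (n + 1) = i + 1 + n by ring, ← h, ← e1, ← e2, ← e3]
    rw [goU_succ]

theorem mkU_eq (d M c n : ℕ) :
    mkU M c (Nat.fib d) (Nat.fib (d + 1)) (Nat.fib (d + 2)) n = tab (d + 1) M c n := by
  have h := goU_eq d M c n 0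
  simp only [Nat.mul_zero, Nat.fib_zero, Nat.zero_mod, Nat.zero_add, Nat.fib_one, tab] at h
  exact h

/-- Value congruent to `fib (s + 1)`. -/
def val0 (c U V s : ℕ) : ℕ :=
  force (Nat.mod (Nat.shiftRight U (Nat.mul (Nat.mul 2 c) (Nat.div s 32)))
    (Nat.pow 2 (Nat.mul 2 c))) fun e =>
  force (Nat.mod (Nat.shiftRight V (Nat.mul 44 (Nat.mod s 32))) (Nat.pow 2 44)) fun g =>
  Nat.add (Nat.mul (Nat.div e (Nat.pow 2 c)) (Nat.div g (Nat.pow 2 22)))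
    (Nat.mul (Nat.mod e (Nat.pow 2 c)) (Nat.mod g (Nat.pow 2 22)))

def tabU (M c n : ℕ) : ℕ := mkU M c 1346269 2178309 3524578 n

def V0 : ℕ := mkU (Nat.pow 2 22) 22 0 1 1 32

theorem tabU_eq (M c n : ℕ) : tabU M c n = tab 32 M c n := by
  have h := mkU_eq 31 M c n
  have e1 : Nat.fib 31 = 1346269 := by norm_num
  have e2 : Nat.fib 32 = 2178309 := by norm_num
  have e3 : Nat.fib 33 = 3524578 := by norm_num
  norm_num only at h
  rw [← h]; rfl

theorem V0_eq : V0 = tab 1 (2 ^ 22) 22 32 := by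
  have h := mkU_eq 0 (2 ^ 22) 22 32
  exact h

theorem ent_parts (d M c i : ℕ) (hM : 0 < M) (hc : M ≤ 2 ^ c) :
    ent d M c i / 2 ^ c = Nat.fib (d * i) % M ∧
    ent d M c i % 2 ^ c = Nat.fib (d * i + 1) % M := by
  have h2 : Nat.fib (d * i + 1) % M < 2 ^ c := lt_of_lt_of_le (Nat.mod_lt _ hM) hc
  unfold ent
  constructor
  · rw [Nat.add_comm, Nat.add_mul_div_right _ _ (by positivity), Nat.div_eq_of_lt h2,
      Nat.zero_add]
  · rw [Nat.add_comm, Nat.add_mul_mod_self_right, Nat.mod_eq_of_lt h2]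

theorem get_aux (U k m : ℕ) :
    Nat.mod (Nat.shiftRight U k) (Nat.pow 2 m) = U / 2 ^ k % 2 ^ m := by
  change (U >>> k) % 2 ^ m = _
  rw [Nat.shiftRight_eq_div_pow]

theorem comb_aux (e g c d : ℕ) :
    Nat.add (Nat.mul (Nat.div e (Nat.pow 2 c)) (Nat.div g (Nat.pow 2 d)))
    (Nat.mul (Nat.mod e (Nat.pow 2 c)) (Nat.mod g (Nat.pow 2 d)))
    = e / 2 ^ c * (g / 2 ^ d) + e % 2 ^ c * (g % 2 ^ d) := rfl

theorem val0_spec (M c n s : ℕ) (hM : 0 < M) (hc : M ≤ 2 ^ c) (hs : s / 32 < n) :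
    val0 c (tabU M c n) V0 s % M = Nat.fib (s + 1) % M := by
  have hv : s % 32 < 32 := Nat.mod_lt _ (by norm_num)
  have eU := tab_get 32 M c n (s / 32) hM hc hs
  have eV := tab_get 1 (2 ^ 22) 22 32 (s % 32) (by norm_num) le_rfl hv
  have pU := ent_parts 32 M c (s / 32) hM hc
  have pV := ent_parts 1 (2 ^ 22) 22 (s % 32) (by norm_num) le_rfl
  have f1 : Nat.fib (1 * (s % 32)) % 2 ^ 22 = Nat.fib (s % 32) := by
    rw [one_mul]; apply Nat.mod_eq_of_lt
    calc Nat.fib (s % 32) ≤ Nat.fib 32 := Nat.fib_mono hv.le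
      _ < 2 ^ 22 := by norm_num
  have f2 : Nat.fib (1 * (s % 32) + 1) % 2 ^ 22 = Nat.fib (s % 32 + 1) := by
    rw [one_mul]; apply Nat.mod_eq_of_lt
    calc Nat.fib (s % 32 + 1) ≤ Nat.fib 32 := Nat.fib_mono hv
      _ < 2 ^ 22 := by norm_num
  have key : val0 c (tabU M c n) V0 s
      = (Nat.fib (32 * (s / 32)) % M) * Nat.fib (s % 32)
        + (Nat.fib (32 * (s / 32) + 1) % M) * Nat.fib (s % 32 + 1) := by
    unfold val0
    simp only [force_eq]
    rw [tabU_eq, V0_eq]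
    have g1 : Nat.mod (Nat.shiftRight (tab 32 M c n) (Nat.mul (Nat.mul 2 c) (Nat.div s 32)))
        (Nat.pow 2 (Nat.mul 2 c)) = ent 32 M c (s / 32) := by
      rw [← eU, get_aux]; rfl
    have g2 : Nat.mod (Nat.shiftRight (tab 1 (2 ^ 22) 22 32) (Nat.mul 44 (Nat.mod s 32)))
        (Nat.pow 2 44) = ent 1 (2 ^ 22) 22 (s % 32) := by
      rw [← eV, get_aux]; rfl
    rw [g1, g2]
    rw [comb_aux]
    rw [pU.1, pU.2, pV.1, pV.2, f1, f2]
  rw [key]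
  conv_rhs => rw [← Nat.div_add_mod s 32, Nat.fib_add]
  simp [Nat.add_mod, Nat.mul_mod]

def val (c P U V s : ℕ) : ℕ := force (Nat.mod s P) fun t => val0 c U V t

/-! Step validity -/

def okStep (N T M P o c : ℕ) : Bool :=
  let U := tabU M c (P / 32 + 1)
  decide (0 < M) && decide (M ≤ 2 ^ c) && decide (0 < P) && decide (N % P = 0) &&
  decide (T % o = 0) && decide (2 ^ 20 * 2 ^ o % M = 2 ^ 20 % M) &&
  decide (val0 c U V0 (P - 1) % M = 0) && decide (val0 c U V0 P % M = 1 % M)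

structure Good (N T M P o c : ℕ) : Prop where
  hM : 0 < M
  hc : M ≤ 2 ^ c
  hP : 0 < P
  hN : P ∣ N
  hT : o ∣ T
  ho : 2 ^ 20 * 2 ^ o ≡ 2 ^ 20 [MOD M]
  f0 : Nat.fib P % M = 0
  f1 : Nat.fib (P + 1) % M = 1 % M

theorem okStep_good {N T M P o c : ℕ} (h : okStep N T M P o c = true) : Good N T M P o c := by
  simp only [okStep, Bool.and_eq_true, decide_eq_true_eq] at h
  obtain ⟨⟨⟨⟨⟨⟨⟨h1, h2⟩, h3⟩, h4⟩, h5⟩, h6⟩, h7⟩, h8⟩ := h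
  refine ⟨h1, h2, h3, Nat.dvd_of_mod_eq_zero h4, Nat.dvd_of_mod_eq_zero h5, h6, ?_, ?_⟩
  · rw [val0_spec _ _ _ _ h1 h2] at h7
    · rwa [Nat.sub_add_cancel h3] at h7
    · have : (P - 1) / 32 ≤ P / 32 := Nat.div_le_div_right (by omega)
      omega
  · rw [val0_spec _ _ _ _ h1 h2] at h8
    · exact h8
    · omega

theorem Good.per {N T M P o c : ℕ} (g : Good N T M P o c) (s k : ℕ) :
    Nat.fib (s + P * k + 1) ≡ Nat.fib (s + 1) [MOD M] := by
  induction k with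
  | zero => exact Nat.ModEq.refl _
  | succ k ih =>
    refine Nat.ModEq.trans ?_ ih
    have : s + P * (k + 1) + 1 = (s + P * k) + P + 1 := by ring
    rw [this, Nat.fib_add]
    have a : Nat.fib P ≡ 0 [MOD M] := by simpa [Nat.ModEq] using g.f0
    have b : Nat.fib (P + 1) ≡ 1 [MOD M] := g.f1
    simpa using (a.mul_left (Nat.fib (s + P * k))).add (b.mul_left (Nat.fib (s + P * k + 1)))

theorem Good.val_spec {N T M P o c : ℕ} (g : Good N T M P o c) {m s : ℕ} (h : m % N = s) :
    val c P (tabU M c (P / 32 + 1)) V0 s ≡ Nat.fib (m + 1) [MOD M] := by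
  have e : s % P = m % P := by
    rw [← h]; exact Nat.mod_mod_of_dvd _ g.hN
  have hlt : m % P < P := Nat.mod_lt _ g.hP
  have h1 : val0 c (tabU M c (P / 32 + 1)) V0 (m % P) ≡ Nat.fib (m % P + 1) [MOD M] := by
    apply val0_spec _ _ _ _ g.hM g.hc
    have : (m % P) / 32 ≤ P / 32 := Nat.div_le_div_right hlt.le
    omega
  have h2 := g.per (m % P) (m / P)
  rw [Nat.mod_add_div] at h2
  unfold val
  rw [force_eq]
  change val0 c (tabU M c (P / 32 + 1)) V0 (s % P) ≡ _ [MOD M]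
  rw [e]
  exact h1.trans h2.symm

theorem Good.pow_spec {N T M P o c : ℕ} (g : Good N T M P o c) {e b : ℕ} (h : e % T = b) :
    2 ^ 20 * 2 ^ (b % o) ≡ 2 ^ 20 * 2 ^ e [MOD M] := by
  have e1 : b % o = e % o := by
    rw [← h]; exact Nat.mod_mod_of_dvd _ g.hT
  rw [e1]
  have key : ∀ k r, 2 ^ 20 * 2 ^ r ≡ 2 ^ 20 * 2 ^ (r + o * k) [MOD M] := by
    intro k r
    induction k with
    | zero => exact Nat.ModEq.refl _
    | succ k ih =>
      refine ih.trans ?_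
      have : 2 ^ 20 * 2 ^ (r + o * (k + 1)) = (2 ^ 20 * 2 ^ o) * 2 ^ (r + o * k) := by
        rw [show r + o * (k + 1) = o + (r + o * k) by ring, pow_add 2 o]; ring
      rw [this]
      exact (g.ho.mul_right _).symm
  have := key (e / o) (e % o)
  rwa [Nat.mod_add_div] at this

/-! Steps -/

def Sol (m1 m2 m3 m4 e : ℕ) : Prop :=
  Nat.fib (m1 + 1) + Nat.fib (m2 + 1) + Nat.fib (m3 + 1) + Nat.fib (m4 + 1) = 2 ^ 20 * 2 ^ e

def NoSol (N T s1 s2 s3 s4 b : ℕ) : Prop :=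
  ∀ m1 m2 m3 m4 e, m1 % N = s1 → m2 % N = s2 → m3 % N = s3 → m4 % N = s4 → e % T = b →
    ¬ Sol m1 m2 m3 m4 e

def Sound (N T : ℕ) (k : ℕ → ℕ → ℕ → ℕ → ℕ → Bool) : Prop :=
  ∀ s1 s2 s3 s4 b, k s1 s2 s3 s4 b = true → NoSol N T s1 s2 s3 s4 b

def goC (N c P U V s : ℕ) (k : PL → Bool) (q : ℕ) : PL → Bool :=
  Nat.rec (motive := fun _ => PL → Bool) k
    (fun j ih acc =>
      force (Nat.add s (Nat.mul N j)) fun t =>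
      force (val c P U V t) fun x => ih (PL.cons t x acc)) q

theorem goC_succ (N c P U V s : ℕ) (k : PL → Bool) (q : ℕ) (acc : PL) :
    goC N c P U V s k (q + 1) acc
      = goC N c P U V s k q (PL.cons (s + N * q) (val c P U V (s + N * q)) acc) := by
  have : goC N c P U V s k (q + 1) acc =
      (force (Nat.add s (Nat.mul N q)) fun t =>
      force (val c P U V t) fun x => goC N c P U V s k q (PL.cons t x acc)) := rfl
  rw [this]
  simp only [force_eq]
  rfl

def collect (q N c P U V s : ℕ) (k : PL → Bool) : Bool := goC N c P U V s k q PL.nil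

theorem collect_spec {q N c P U V s : ℕ} {k : PL → Bool} (h : collect q N c P U V s k = true) :
    ∃ l, k l = true ∧ ∀ j < q, PL.Mem (s + N * j) (val c P U V (s + N * j)) l := by
  have gen : ∀ q acc, goC N c P U V s k q acc = true →
      ∃ l, k l = true ∧ (∀ j < q, PL.Mem (s + N * j) (val c P U V (s + N * j)) l) ∧
        ∀ t x, PL.Mem t x acc → PL.Mem t x l := by
    intro q
    induction q with
    | zero => intro acc h; exact ⟨acc, h, by simp, fun _ _ h => h⟩
    | succ q ih =>
      intro acc h
      rw [goC_succ] at h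
      obtain ⟨l, h1, h2, h3⟩ := ih _ h
      refine ⟨l, h1, ?_, fun t x ht => h3 _ _ (Or.inr ht)⟩
      intro j hj
      rcases Nat.lt_succ_iff_lt_or_eq.mp hj with h4 | rfl
      · exact h2 j h4
      · exact h3 _ _ (Or.inl ⟨rfl, rfl⟩)
  obtain ⟨l, h1, h2, _⟩ := gen q PL.nil h
  exact ⟨l, h1, h2⟩

def stepN (q N M P o c : ℕ) (V U : ℕ) (k : ℕ → ℕ → ℕ → ℕ → ℕ → Bool)
    (s1 s2 s3 s4 b : ℕ) : Bool :=
  force (Nat.mod (Nat.mul (Nat.pow 2 20) (Nat.pow 2 (Nat.mod b o))) M) fun X =>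
  collect q N c P U V s1 fun l1 =>
  collect q N c P U V s2 fun l2 =>
  collect q N c P U V s3 fun l3 =>
  collect q N c P U V s4 fun l4 =>
  allP l1 fun t1 x1 =>
  allP l2 fun t2 x2 => force (Nat.add x1 x2) fun x12 =>
  allP l3 fun t3 x3 => force (Nat.add x12 x3) fun x123 =>
  allP l4 fun t4 x4 =>
  sel (Nat.beq (Nat.mod (Nat.add x123 x4) M) X) (k t1 t2 t3 t4 b) true

theorem stepN_sound {q N T M P o c : ℕ} {k : ℕ → ℕ → ℕ → ℕ → ℕ → Bool} (hq : 0 < q)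
    (hk : Sound (N * q) T k) (hok : okStep (N * q) T M P o c = true) :
    Sound N T (stepN q N M P o c V0 (tabU M c (P / 32 + 1)) k) := by
  have g := okStep_good hok
  intro s1 s2 s3 s4 b h m1 m2 m3 m4 e h1 h2 h3 h4 he hsol
  unfold stepN at h
  simp only [force_eq] at h
  have lift : ∀ {m s : ℕ}, m % N = s → m % (N * q) = s + N * ((m / N) % q) := by
    intro m s h; rw [Nat.mod_mul, h]
  obtain ⟨l1, h, c1⟩ := collect_spec h
  obtain ⟨l2, h, c2⟩ := collect_spec h
  obtain ⟨l3, h, c3⟩ := collect_spec h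
  obtain ⟨l4, h, c4⟩ := collect_spec h
  have h := allP_spec h (c1 _ (Nat.mod_lt (m1 / N) hq))
  have h := allP_spec h (c2 _ (Nat.mod_lt (m2 / N) hq))
  have h := allP_spec h (c3 _ (Nat.mod_lt (m3 / N) hq))
  have h := allP_spec h (c4 _ (Nat.mod_lt (m4 / N) hq))
  have v1 := g.val_spec (lift h1)
  have v2 := g.val_spec (lift h2)
  have v3 := g.val_spec (lift h3)
  have v4 := g.val_spec (lift h4)
  have hp := g.pow_spec he
  have hb := sel_true h (by
    apply beq_of_eq
    have := ((v1.add v2).add v3).add v4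
    rw [show _ = _ from hsol] at this
    exact this.trans hp.symm)
  exact hk _ _ _ _ _ hb m1 m2 m3 m4 e (lift h1) (lift h2) (lift h3) (lift h4) he hsol

def stepT (q T M P o c : ℕ) (V U : ℕ) (k : ℕ → ℕ → ℕ → ℕ → ℕ → Bool)
    (s1 s2 s3 s4 b : ℕ) : Bool :=
  force (Nat.mod (Nat.add (Nat.add (Nat.add (val c P U V s1) (val c P U V s2)) (val c P U V s3))
    (val c P U V s4)) M) fun S =>
  allLt q fun j => force (Nat.add b (Nat.mul T j)) fun b' =>
  sel (Nat.beq S (Nat.mod (Nat.mul (Nat.pow 2 20) (Nat.pow 2 (Nat.mod b' o))) M))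
    (k s1 s2 s3 s4 b') true

theorem stepT_sound {q N T M P o c : ℕ} {k : ℕ → ℕ → ℕ → ℕ → ℕ → Bool} (hq : 0 < q)
    (hk : Sound N (T * q) k) (hok : okStep N (T * q) M P o c = true) :
    Sound N T (stepT q T M P o c V0 (tabU M c (P / 32 + 1)) k) := by
  have g := okStep_good hok
  intro s1 s2 s3 s4 b h m1 m2 m3 m4 e h1 h2 h3 h4 he hsol
  unfold stepT at h
  simp only [force_eq] at h
  have he' : e % (T * q) = b + T * ((e / T) % q) := by rw [Nat.mod_mul, he]
  have h := allLt_spec h (Nat.mod_lt (e / T) hq)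
  have v1 := g.val_spec h1
  have v2 := g.val_spec h2
  have v3 := g.val_spec h3
  have v4 := g.val_spec h4
  have hp := g.pow_spec he'
  have hb := sel_true h (by
    apply beq_of_eq
    have := ((v1.add v2).add v3).add v4
    rw [show _ = _ from hsol] at this
    exact this.trans hp.symm)
  exact hk _ _ _ _ _ hb m1 m2 m3 m4 e h1 h2 h3 h4 he' hsol

/-- First lifting step: only sorted tuples are considered. -/
def stepS (q M P o c : ℕ) (V U : ℕ) (k : ℕ → ℕ → ℕ → ℕ → ℕ → Bool) (b : ℕ) : Bool :=
  force (Nat.mod (Nat.mul (Nat.pow 2 20) (Nat.pow 2 (Nat.mod b o))) M) fun X =>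
  collect q 1 c P U V 0 fun l =>
  allP l fun t1 x1 =>
  allP l fun t2 x2 => sel (Nat.ble t1 t2) (force (Nat.add x1 x2) fun x12 =>
  allP l fun t3 x3 => sel (Nat.ble t2 t3) (force (Nat.add x12 x3) fun x123 =>
  allP l fun t4 x4 => sel (Nat.ble t3 t4)
  (sel (Nat.beq (Nat.mod (Nat.add x123 x4) M) X) (k t1 t2 t3 t4 b) true) true) true) true

theorem stepS_sound {q T M P o c : ℕ} {k : ℕ → ℕ → ℕ → ℕ → ℕ → Bool} (hq : 0 < q)
    (hk : Sound q T k) (hok : okStep q T M P o c = true) {b : ℕ}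
    (h : stepS q M P o c V0 (tabU M c (P / 32 + 1)) k b = true)
    (m1 m2 m3 m4 e : ℕ) (h12 : m1 % q ≤ m2 % q) (h23 : m2 % q ≤ m3 % q) (h34 : m3 % q ≤ m4 % q)
    (he : e % T = b) : ¬ Sol m1 m2 m3 m4 e := by
  have g := okStep_good hok
  intro hsol
  unfold stepS at h
  simp only [force_eq] at h
  obtain ⟨l, h, cc⟩ := collect_spec h
  simp only [Nat.zero_add, Nat.one_mul] at cc
  have h := allP_spec h (cc _ (Nat.mod_lt m1 hq))
  have h := allP_spec h (cc _ (Nat.mod_lt m2 hq))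
  have h := sel_true h (Nat.ble_eq.mpr h12)
  have h := allP_spec h (cc _ (Nat.mod_lt m3 hq))
  have h := sel_true h (Nat.ble_eq.mpr h23)
  have h := allP_spec h (cc _ (Nat.mod_lt m4 hq))
  have h := sel_true h (Nat.ble_eq.mpr h34)
  have v1 := g.val_spec (m := m1) rfl
  have v2 := g.val_spec (m := m2) rfl
  have v3 := g.val_spec (m := m3) rfl
  have v4 := g.val_spec (m := m4) rfl
  have hp := g.pow_spec he
  have hb := sel_true h (by
    apply beq_of_eq
    have := ((v1.add v2).add v3).add v4
    rw [show _ = _ from hsol] at this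
    exact this.trans hp.symm)
  exact hk _ _ _ _ _ hb m1 m2 m3 m4 e rfl rfl rfl rfl he hsol

theorem sort4 (Q : ℕ → ℕ → ℕ → ℕ → Prop) (f : ℕ → ℕ)
    (s12 : ∀ a b c d, Q a b c d → Q b a c d) (s23 : ∀ a b c d, Q a b c d → Q a c b d)
    (s34 : ∀ a b c d, Q a b c d → Q a b d c)
    (h : ∀ a b c d, f a ≤ f b → f b ≤ f c → f c ≤ f d → Q a b c d) (a b c d : ℕ) : Q a b c d := by
  have A : ∀ a b c d, f b ≤ f c → f c ≤ f d → Q a b c d := by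
    intro a b c d h2 h3
    rcases le_total (f a) (f b) with h1 | h1
    · exact h _ _ _ _ h1 h2 h3
    rcases le_total (f a) (f c) with h4 | h4
    · exact s12 _ _ _ _ (h _ _ _ _ h1 h4 h3)
    rcases le_total (f a) (f d) with h5 | h5
    · exact s12 _ _ _ _ (s23 _ _ _ _ (h _ _ _ _ h2 h4 h5))
    · exact s12 _ _ _ _ (s23 _ _ _ _ (s34 _ _ _ _ (h _ _ _ _ h2 h3 h5)))
  have B : ∀ a b c d, f c ≤ f d → Q a b c d := by
    intro a b c d h3
    rcases le_total (f b) (f c) with h1 | h1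
    · exact A _ _ _ _ h1 h3
    rcases le_total (f b) (f d) with h4 | h4
    · exact s23 _ _ _ _ (A _ _ _ _ h1 h4)
    · exact s23 _ _ _ _ (s34 _ _ _ _ (A _ _ _ _ h3 h4))
  rcases le_total (f c) (f d) with h1 | h1
  · exact B _ _ _ _ h1
  · exact s34 _ _ _ _ (B _ _ _ _ h1)

def chain (V W0 W1 W2 W3 W4 W5 W6 W7 W8 W9 W10 W11 W12 W13 W14 W15 W16 : ℕ) : ℕ → ℕ → ℕ → ℕ → ℕ → Bool :=
  stepT 2 10 1 1 1 1 V W0 (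
  stepN 2 10 5 20 4 3 V W1 (
  stepN 2 20 123 40 20 7 V W2 (
  stepN 3 40 496 120 5 9 V W3 (
  stepT 3 20 549 120 60 10 V W4 (
  stepN 2 120 224 48 3 8 V W5 (
  stepT 2 60 241 240 24 8 V W6 (
  stepT 9 120 2161 80 1080 12 V W7 (
  stepN 2 240 64 96 1 7 V W8 (
  stepT 10 1080 1601 160 400 11 V W9 (
  stepN 2 480 128 192 1 8 V W10 (
  stepT 16 10800 769 192 384 10 V W11 (
  stepN 2 960 164096 1920 64 18 V W12 (
  stepN 2 1920 512 768 1 10 V W13 (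
  stepN 2 3840 7865344 7680 3840 23 V W14 (
  stepT 2 172800 1 1 1 1 V W15 (
  stepN 2 7680 3460302848 15360 38400 32 V W16 (
  fun _ _ _ _ _ => false)))))))))))))))))

def total (b : ℕ) : Bool :=
  force V0 fun V =>
  force (tabU 11 4 1) fun U =>
  force (tabU 1 1 1) fun W0 =>
  force (tabU 5 3 1) fun W1 =>
  force (tabU 123 7 2) fun W2 =>
  force (tabU 496 9 4) fun W3 =>
  force (tabU 549 10 4) fun W4 =>
  force (tabU 224 8 2) fun W5 =>
  force (tabU 241 8 8) fun W6 =>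
  force (tabU 2161 12 3) fun W7 =>
  force (tabU 64 7 4) fun W8 =>
  force (tabU 1601 11 6) fun W9 =>
  force (tabU 128 8 7) fun W10 =>
  force (tabU 769 10 7) fun W11 =>
  force (tabU 164096 18 61) fun W12 =>
  force (tabU 512 10 25) fun W13 =>
  force (tabU 7865344 23 241) fun W14 =>
  force (tabU 1 1 1) fun W15 =>
  force (tabU 3460302848 32 481) fun W16 =>
  stepS 10 11 10 10 4 V U (chain V W0 W1 W2 W3 W4 W5 W6 W7 W8 W9 W10 W11 W12 W13 W14 W15 W16) b

theorem chain_sound : Sound 10 10 (chain V0 (tabU 1 1 1) (tabU 5 3 1) (tabU 123 7 2) (tabU 496 9 4) (tabU 549 10 4) (tabU 224 8 2) (tabU 241 8 8) (tabU 2161 12 3) (tabU 64 7 4) (tabU 1601 11 6) (tabU 128 8 7) (tabU 769 10 7) (tabU 164096 18 61) (tabU 512 10 25) (tabU 7865344 23 241) (tabU 1 1 1) (tabU 3460302848 32 481)) := by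
  unfold chain
  refine stepT_sound (N := 10) (T := 10) (by norm_num) ?_ (by decide +kernel)
  refine stepN_sound (N := 10) (T := 20) (by norm_num) ?_ (by decide +kernel)
  refine stepN_sound (N := 20) (T := 20) (by norm_num) ?_ (by decide +kernel)
  refine stepN_sound (N := 40) (T := 20) (by norm_num) ?_ (by decide +kernel)
  refine stepT_sound (N := 120) (T := 20) (by norm_num) ?_ (by decide +kernel)
  refine stepN_sound (N := 120) (T := 60) (by norm_num) ?_ (by decide +kernel)
  refine stepT_sound (N := 240) (T := 60) (by norm_num) ?_ (by decide +kernel)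
  refine stepT_sound (N := 240) (T := 120) (by norm_num) ?_ (by decide +kernel)
  refine stepN_sound (N := 240) (T := 1080) (by norm_num) ?_ (by decide +kernel)
  refine stepT_sound (N := 480) (T := 1080) (by norm_num) ?_ (by decide +kernel)
  refine stepN_sound (N := 480) (T := 10800) (by norm_num) ?_ (by decide +kernel)
  refine stepT_sound (N := 960) (T := 10800) (by norm_num) ?_ (by decide +kernel)
  refine stepN_sound (N := 960) (T := 172800) (by norm_num) ?_ (by decide +kernel)
  refine stepN_sound (N := 1920) (T := 172800) (by norm_num) ?_ (by decide +kernel)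
  refine stepN_sound (N := 3840) (T := 172800) (by norm_num) ?_ (by decide +kernel)
  refine stepT_sound (N := 7680) (T := 172800) (by norm_num) ?_ (by decide +kernel)
  refine stepN_sound (N := 7680) (T := 345600) (by norm_num) ?_ (by decide +kernel)
  intro _ _ _ _ _ h
  exact absurd h (by simp)

theorem total_true : allLt 10 total = true := by decide +kernel

theorem no_sol (m1 m2 m3 m4 e : ℕ) : ¬ Sol m1 m2 m3 m4 e := by
  refine sort4 (fun m1 m2 m3 m4 => ¬ Sol m1 m2 m3 m4 e) (fun m => m % 10) ?_ ?_ ?_ ?_ m1 m2 m3 m4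
  · intro a b c d h h'; apply h; unfold Sol at *; omega
  · intro a b c d h h'; apply h; unfold Sol at *; omega
  · intro a b c d h h'; apply h; unfold Sol at *; omega
  intro a b c d h1 h2 h3
  have h := allLt_spec total_true (Nat.mod_lt e (by norm_num : 0 < 10))
  unfold total at h
  simp only [force_eq] at h
  exact stepS_sound (T := 10) (by norm_num) chain_sound (by decide +kernel) h a b c d e h1 h2 h3 rfl

end

end FibPow

/-- If positive integers `n1 ≥ n2 ≥ n3 ≥ n4` and `a` satisfy
`F_{n1} + F_{n2} + F_{n3} + F_{n4} = 2^a` with `n1 ≥ 3`, then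
`(n1 − n2)·log α < 2.32 × 10^12 · log n1`. -/
theorem bound_n1_sub_n2
    (n1 n2 n3 n4 a : ℕ) (hn4 : 0 < n4) (ha : 0 < a) (hn1 : 3 ≤ n1)
    (h12 : n2 ≤ n1) (h23 : n3 ≤ n2) (h34 : n4 ≤ n3)
    (h : Nat.fib n1 + Nat.fib n2 + Nat.fib n3 + Nat.fib n4 = 2 ^ a) :
    ((n1 : ℝ) - (n2 : ℝ)) * Real.log ((1 + Real.sqrt 5) / 2) <
      2.32 * 10 ^ 12 * Real.log n1 := by
  have ha20 : a < 20 := by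
    by_contra hc
    apply FibPow.no_sol (n1 - 1) (n2 - 1) (n3 - 1) (n4 - 1) (a - 20)
    unfold FibPow.Sol
    rw [Nat.sub_add_cancel (by omega), Nat.sub_add_cancel (by omega),
      Nat.sub_add_cancel (by omega), Nat.sub_add_cancel (by omega), h, ← pow_add]
    congr 1; omega
  have hn : n1 < 31 := by
    by_contra hc
    have h1 : Nat.fib 31 ≤ Nat.fib n1 := Nat.fib_mono (by omega)
    have h2 : (2 : ℕ) ^ a ≤ 2 ^ 20 := Nat.pow_le_pow_right (by norm_num) ha20.le
    have h3 : Nat.fib 31 = 1346269 := by norm_num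
    have h4 : (2 : ℕ) ^ 20 = 1048576 := by norm_num
    omega
  have hs : Real.sqrt 5 ≤ 3 := by
    rw [Real.sqrt_le_left (by norm_num)]; norm_num
  have hs0 : 1 ≤ Real.sqrt 5 := by
    rw [Real.one_le_sqrt]; norm_num
  have hl : Real.log ((1 + Real.sqrt 5) / 2) ≤ 1 := by
    have := Real.log_le_sub_one_of_pos (x := (1 + Real.sqrt 5) / 2) (by linarith)
    linarith
  have hl0 : 0 ≤ Real.log ((1 + Real.sqrt 5) / 2) := Real.log_nonneg (by linarith)
  have hd : (n1 : ℝ) - n2 ≤ 31 := by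
    have h1 : (n1 : ℝ) ≤ 31 := by exact_mod_cast hn.le
    have h2 : (0 : ℝ) ≤ n2 := Nat.cast_nonneg _
    linarith
  have hL : 1 / 2 ≤ Real.log n1 := by
    have h2 : Real.log 2 ≤ Real.log n1 :=
      Real.log_le_log (by norm_num) (by exact_mod_cast (by omega : 2 ≤ n1))
    have := Real.log_two_gt_d9
    linarith
  have : ((n1 : ℝ) - n2) * Real.log ((1 + Real.sqrt 5) / 2) ≤ 31 * 1 :=
    mul_le_mul hd hl hl0 (by norm_num)
  have : (2.32 * 10 ^ 12 : ℝ) * (1 / 2) ≤ 2.32 * 10 ^ 12 * Real.log n1 :=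
    mul_le_mul_of_nonneg_left hL (by norm_num)
  norm_num at *
  linarith
end
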